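/- arXiv:1002.2993 — 2 statements merged into one kernel-verified Lean document; each statement's English description precedes it below -/
import Mathlib

section
/- Every fixed-point-free smooth involution of the 2-sphere is smoothly conjugate to the antipodal map: if φ : S² → S² is a diffeomorphism (for the standard smooth structure on S²) with φ ∘ φ = id and φ(x) ≠ x for all x ∈ S², then there exists a diffeomorphism ψ : S² → S² such that φ = ψ ∘ 𝔞 ∘ ψ⁻¹, where 𝔞 : S² → S² is the antipodal map x ↦ −x. -/
open scoped Manifold

/-- The unit 2-sphere in Euclidean `ℝ³`, with its standard smooth structure. -/
noncomputable abbrev Sphere2 : Type :=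
  Metric.sphere (0 : EuclideanSpace ℝ (Fin 3)) 1

/-- The antipodal map `𝔞 : x ↦ −x` of the 2-sphere. -/
noncomputable def antipodal (x : Sphere2) : Sphere2 :=
  ⟨-(x : EuclideanSpace ℝ (Fin 3)), by
    rw [mem_sphere_zero_iff_norm, norm_neg, ← mem_sphere_zero_iff_norm]
    exact x.2⟩


namespace Inv17
open MeasureTheory Complex Set Filter Topology
open scoped ContDiff Convolution

/-- Directional derivative of a complex-valued function of a complex variable. -/
noncomputable def dd (v : ℂ) (f : ℂ → ℂ) (z : ℂ) : ℂ := fderiv ℝ f z v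

/-- The Wirtinger derivative `∂/∂z`. -/
noncomputable def dz (f : ℂ → ℂ) (z : ℂ) : ℂ := (dd 1 f z - I * dd I f z) / 2

/-- The Wirtinger derivative `∂/∂z̄`. -/
noncomputable def db (f : ℂ → ℂ) (z : ℂ) : ℂ := (dd 1 f z + I * dd I f z) / 2

/-- Test functions: smooth with compact support. -/
structure TF (f : ℂ → ℂ) : Prop where
  smooth : ContDiff ℝ ∞ f
  supp : HasCompactSupport f

lemma contDiff_dd {f : ℂ → ℂ} (hf : ContDiff ℝ ∞ f) (v : ℂ) : ContDiff ℝ ∞ (dd v f) := by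
  unfold dd
  exact (hf.fderiv_right (m := ∞) (by simp)).clm_apply contDiff_const

lemma contDiff_dz {f : ℂ → ℂ} (hf : ContDiff ℝ ∞ f) : ContDiff ℝ ∞ (dz f) := by
  unfold dz
  exact ((contDiff_dd hf 1).sub (contDiff_const.mul (contDiff_dd hf I))).div_const _

lemma contDiff_db {f : ℂ → ℂ} (hf : ContDiff ℝ ∞ f) : ContDiff ℝ ∞ (db f) := by
  unfold db
  exact ((contDiff_dd hf 1).add (contDiff_const.mul (contDiff_dd hf I))).div_const _

lemma TF.dd {f : ℂ → ℂ} (hf : TF f) (v : ℂ) : TF (dd v f) :=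
  ⟨contDiff_dd hf.smooth v, hf.supp.fderiv_apply ℝ v⟩

lemma TF.cmul {f : ℂ → ℂ} (hf : TF f) {c : ℂ → ℂ} (hc : ContDiff ℝ ∞ c) :
    TF (fun z => c z * f z) :=
  ⟨hc.mul hf.smooth, hf.supp.mul_left⟩

lemma TF.mulc {f : ℂ → ℂ} (hf : TF f) {c : ℂ → ℂ} (hc : ContDiff ℝ ∞ c) :
    TF (fun z => f z * c z) :=
  ⟨hf.smooth.mul hc, hf.supp.mul_right⟩

lemma TF.add {f g : ℂ → ℂ} (hf : TF f) (hg : TF g) : TF (fun z => f z + g z) :=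
  ⟨hf.smooth.add hg.smooth, hf.supp.add hg.supp⟩

lemma TF.sub {f g : ℂ → ℂ} (hf : TF f) (hg : TF g) : TF (fun z => f z - g z) := by
  have := hf.add (hg.cmul (c := fun _ => -1) contDiff_const)
  simpa [sub_eq_add_neg] using this

lemma TF.dz {f : ℂ → ℂ} (hf : TF f) : TF (dz f) := by
  have := ((hf.dd 1).sub ((hf.dd I).cmul (c := fun _ => I) contDiff_const)).mulc
    (c := fun _ => 1/2) contDiff_const
  convert this using 1
  ext z; simp only [Inv17.dz]; ring

lemma TF.db {f : ℂ → ℂ} (hf : TF f) : TF (db f) := by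
  have := ((hf.dd 1).add ((hf.dd I).cmul (c := fun _ => I) contDiff_const)).mulc
    (c := fun _ => 1/2) contDiff_const
  convert this using 1
  ext z; simp only [Inv17.db]; ring

lemma TF.cont {f : ℂ → ℂ} (hf : TF f) : Continuous f := hf.smooth.continuous

lemma TF.integrable {f : ℂ → ℂ} (hf : TF f) : Integrable f :=
  hf.cont.integrable_of_hasCompactSupport hf.supp

lemma diffAt {f : ℂ → ℂ} (hf : ContDiff ℝ ∞ f) (z : ℂ) : DifferentiableAt ℝ f z :=
  (hf.differentiable (by simp)) z

lemma dd_add {f g : ℂ → ℂ} (hf : ContDiff ℝ ∞ f) (hg : ContDiff ℝ ∞ g) (v z : ℂ) :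
    dd v (fun z => f z + g z) z = dd v f z + dd v g z := by
  unfold dd; rw [fderiv_fun_add (diffAt hf z) (diffAt hg z)]; rfl

lemma dd_sub {f g : ℂ → ℂ} (hf : ContDiff ℝ ∞ f) (hg : ContDiff ℝ ∞ g) (v z : ℂ) :
    dd v (fun z => f z - g z) z = dd v f z - dd v g z := by
  unfold dd; rw [fderiv_fun_sub (diffAt hf z) (diffAt hg z)]; rfl

lemma dd_mul {f g : ℂ → ℂ} (hf : ContDiff ℝ ∞ f) (hg : ContDiff ℝ ∞ g) (v z : ℂ) :
    dd v (fun z => f z * g z) z = dd v f z * g z + f z * dd v g z := by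
  unfold dd; rw [fderiv_fun_mul (diffAt hf z) (diffAt hg z)]; simp; ring

lemma dd_const (c v z : ℂ) : dd v (fun _ => c) z = 0 := by
  unfold dd; simp

lemma dd_comm {f : ℂ → ℂ} (hf : ContDiff ℝ ∞ f) (v w : ℂ) : dd v (dd w f) = dd w (dd v f) := by
  ext z
  have h := ((contDiff_infty.1 hf 2).contDiffAt (x := z)).isSymmSndFDerivAt (by simp)
  have hd : DifferentiableAt ℝ (fderiv ℝ f) z :=
    ((hf.fderiv_right (m := ∞) (by simp)).differentiable (by simp)) z
  unfold dd
  rw [fderiv_clm_apply hd (by fun_prop), fderiv_clm_apply hd (by fun_prop)]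
  simpa using h v w

lemma dz_add {f g : ℂ → ℂ} (hf : ContDiff ℝ ∞ f) (hg : ContDiff ℝ ∞ g) (z : ℂ) :
    dz (fun z => f z + g z) z = dz f z + dz g z := by
  unfold dz; rw [dd_add hf hg, dd_add hf hg]; ring

lemma db_add {f g : ℂ → ℂ} (hf : ContDiff ℝ ∞ f) (hg : ContDiff ℝ ∞ g) (z : ℂ) :
    db (fun z => f z + g z) z = db f z + db g z := by
  unfold db; rw [dd_add hf hg, dd_add hf hg]; ring

lemma dz_mul {f g : ℂ → ℂ} (hf : ContDiff ℝ ∞ f) (hg : ContDiff ℝ ∞ g) (z : ℂ) :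
    dz (fun z => f z * g z) z = dz f z * g z + f z * dz g z := by
  unfold dz; rw [dd_mul hf hg, dd_mul hf hg]; ring

lemma dd_dz {f : ℂ → ℂ} (hf : ContDiff ℝ ∞ f) (v : ℂ) : dd v (dz f) = dz (dd v f) := by
  ext z
  have e : dz f = fun z => (dd 1 f z - I * dd I f z) * (1/2) := by
    ext z; simp [dz]; ring
  have h1 := contDiff_dd hf 1
  have h2 := contDiff_dd hf I
  rw [e, dd_mul (h1.sub (contDiff_const.mul h2)) contDiff_const, dd_sub h1 (contDiff_const.mul h2),
    dd_mul contDiff_const h2, dd_const, dd_const, dd_comm hf v 1, dd_comm hf v I]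
  unfold dz; ring

/-- The Cauchy kernel. -/
noncomputable def ker (z : ℂ) : ℂ := ((Real.pi : ℂ) * z)⁻¹

lemma norm_ker (z : ℂ) : ‖ker z‖ = Real.pi⁻¹ * ‖z‖⁻¹ := by
  simp [ker, abs_of_pos Real.pi_pos, mul_comm]

lemma measurable_ker : Measurable ker := by
  unfold ker; fun_prop

lemma ker_locInt : LocallyIntegrable ker (volume : Measure ℂ) := by
  refine locallyIntegrable_of_norm_le_rpow (C := Real.pi⁻¹) (α := 1) (by simp) (by simp) ?_
    measurable_ker.aestronglyMeasurable
  refine Eventually.of_forall fun x => ?_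
  rw [norm_ker, Real.rpow_neg_one]

/-- The Cauchy transform. -/
noncomputable def CT (h : ℂ → ℂ) : ℂ → ℂ :=
  ker ⋆[ContinuousLinearMap.mul ℝ ℂ, volume] h

lemma CT_apply (h : ℂ → ℂ) (z : ℂ) : CT h z = ∫ w, ker w * h (z - w) := rfl

lemma CT_apply' (h : ℂ → ℂ) (z : ℂ) : CT h z = ∫ w, ker (z - w) * h w := by
  rw [CT, convolution_eq_swap]; rfl

lemma TF.CT_int {h : ℂ → ℂ} (hh : TF h) (z : ℂ) : Integrable (fun w => ker w * h (z - w)) :=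
  hh.supp.convolutionExists_right (ContinuousLinearMap.mul ℝ ℂ) ker_locInt hh.cont z

lemma TF.CT_int' {h : ℂ → ℂ} (hh : TF h) (z : ℂ) : Integrable (fun w => ker (z - w) * h w) := by
  have := (hh.CT_int z).comp_sub_left z
  simpa using this

lemma TF.CT_smooth {h : ℂ → ℂ} (hh : TF h) : ContDiff ℝ ∞ (CT h) :=
  hh.supp.contDiff_convolution_right _ ker_locInt hh.smooth

lemma TF.dd_CT {h : ℂ → ℂ} (hh : TF h) (v : ℂ) : Inv17.dd v (CT h) = CT (Inv17.dd v h) := by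
  ext z
  have h1 := (hh.supp.hasFDerivAt_convolution_right (ContinuousLinearMap.mul ℝ ℂ) ker_locInt
    (hh.smooth.of_le (by simp)) z).fderiv
  unfold Inv17.dd
  rw [show CT h = ker ⋆[ContinuousLinearMap.mul ℝ ℂ, volume] h from rfl, h1,
    convolution_precompR_apply _ ker_locInt (hh.supp.fderiv ℝ)
      (hh.smooth.continuous_fderiv (by simp))]
  rfl

lemma CT_add {f g : ℂ → ℂ} (hf : TF f) (hg : TF g) :
    CT (fun z => f z + g z) = fun z => CT f z + CT g z := by
  ext z; simp only [CT_apply, mul_add]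
  exact integral_add (hf.CT_int z) (hg.CT_int z)

lemma CT_cmul {f : ℂ → ℂ} (c : ℂ) : CT (fun z => c * f z) = fun z => c * CT f z := by
  ext z; simp only [CT_apply, ← integral_const_mul]; congr 1; ext; ring

lemma CT_sub {f g : ℂ → ℂ} (hf : TF f) (hg : TF g) :
    CT (fun z => f z - g z) = fun z => CT f z - CT g z := by
  ext z; simp only [CT_apply, mul_sub]
  exact integral_sub (hf.CT_int z) (hg.CT_int z)

lemma TF.dz_CT {h : ℂ → ℂ} (hh : TF h) : Inv17.dz (CT h) = CT (Inv17.dz h) := by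
  have : Inv17.dz h = fun z => (1/2) * (Inv17.dd 1 h z - I * Inv17.dd I h z) := by
    ext z; simp only [Inv17.dz]; ring
  rw [this, CT_cmul, CT_sub (hh.dd 1) ((hh.dd I).cmul (c := fun _ => I) contDiff_const), CT_cmul,
    ← hh.dd_CT, ← hh.dd_CT]
  ext z; simp only [Inv17.dz]; ring

lemma TF.db_CT {h : ℂ → ℂ} (hh : TF h) : Inv17.db (CT h) = CT (Inv17.db h) := by
  have : Inv17.db h = fun z => (1/2) * (Inv17.dd 1 h z + I * Inv17.dd I h z) := by
    ext z; simp only [Inv17.db]; ring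
  rw [this, CT_cmul, CT_add (hh.dd 1) ((hh.dd I).cmul (c := fun _ => I) contDiff_const), CT_cmul,
    ← hh.dd_CT, ← hh.dd_CT]
  ext z; simp only [Inv17.db]; ring

end Inv17


namespace Inv17
open MeasureTheory Complex Set Filter Topology
open scoped ContDiff Convolution

/-- The unit vector of angle `θ`. -/
noncomputable def eth (θ : ℝ) : ℂ := Real.cos θ + Real.sin θ * I

lemma norm_eth (θ : ℝ) : ‖eth θ‖ = 1 := by
  unfold eth; rw [Complex.norm_add_mul_I]; simp

lemma continuous_eth : Continuous eth := by unfold eth; fun_prop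

lemma hasDerivAt_eth (θ : ℝ) : HasDerivAt eth (I * eth θ) θ := by
  have h1 := (Real.hasDerivAt_cos θ).ofReal_comp
  have h2 := ((Real.hasDerivAt_sin θ).ofReal_comp).mul_const I
  have := h1.add h2
  convert! this using 1
  simp only [eth]; push_cast
  linear_combination (Complex.sin θ) * I_mul_I

lemma TF.bound {h : ℂ → ℂ} (hh : TF h) : ∃ R > 0, ∀ w, R ≤ ‖w‖ → h w = 0 := by
  obtain ⟨R, hR, h2⟩ := hh.supp.isCompact.isBounded.exists_pos_norm_lt
  refine ⟨R, hR, fun w hw => ?_⟩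
  by_contra hc
  have := h2 w (subset_tsupport _ hc)
  linarith

lemma fd_decomp {f : ℂ → ℂ} (z v : ℂ) :
    fderiv ℝ f z v = v.re * dd 1 f z + v.im * dd I f z := by
  have : v = v.re • (1:ℂ) + v.im • I := by
    simp [Complex.re_add_im]
  conv_lhs => rw [this]
  rw [map_add, map_smul, map_smul]; simp [dd]

lemma CT_db {h : ℂ → ℂ} (hh : TF h) (z : ℂ) : CT (db h) z = h z := by
  have hdc : Continuous (fderiv ℝ h) := hh.smooth.continuous_fderiv (by simp)
  obtain ⟨R, hR, hRh⟩ := hh.bound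
  have hRd : ∀ w, R < ‖w‖ → fderiv ℝ h w = 0 := by
    intro w hw
    have : h =ᶠ[𝓝 w] fun _ => 0 := by
      filter_upwards [(isOpen_lt continuous_const continuous_norm).mem_nhds hw] with y hy
      exact hRh y (le_of_lt hy)
    rw [this.fderiv_eq]; simp
  set P : ℝ × ℝ → ℂ := fun p => z - p.1 * eth p.2 with hP
  have hPc : Continuous P := by
    have := continuous_eth; rw [hP]; fun_prop
  set A : ℝ × ℝ → ℂ := fun p => fderiv ℝ h (P p) (eth p.2) with hA
  set B : ℝ × ℝ → ℂ := fun p => fderiv ℝ h (P p) (I * eth p.2) with hB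
  have hAc : Continuous A := (hdc.comp hPc).clm_apply (continuous_eth.comp continuous_snd)
  have hBc : Continuous B := (hdc.comp hPc).clm_apply
    (continuous_const.mul (continuous_eth.comp continuous_snd))
  set T : Set (ℝ × ℝ) := Ioi (0:ℝ) ×ˢ Ioo (-Real.pi) Real.pi with hT
  have hTm : MeasurableSet T := measurableSet_Ioi.prod measurableSet_Ioo
  have hfar : ∀ p ∈ T \ (Icc (0:ℝ) (R + ‖z‖) ×ˢ Icc (-Real.pi) Real.pi), R < ‖P p‖ := by
    rintro ⟨r, θ⟩ ⟨⟨h1, h2⟩, h3⟩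
    simp only [mem_Ioi, mem_Ioo, mem_prod, mem_Icc, not_and_or, not_le] at h1 h2 h3
    have hr : R + ‖z‖ < r := by
      rcases h3 with (h | h) | (h | h) <;> linarith
    have : ‖(r:ℂ) * eth θ‖ ≤ ‖P (r, θ)‖ + ‖z‖ := by
      have := norm_sub_le z (P (r, θ))
      simp only [hP, sub_sub_cancel] at this ⊢
      linarith
    rw [norm_mul, norm_eth, mul_one, Complex.norm_real, Real.norm_of_nonneg h1.le] at this
    linarith
  have hIntg : ∀ F : ℝ × ℝ → ℂ, Continuous F → (∀ p, fderiv ℝ h (P p) = 0 → F p = 0) →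
      IntegrableOn F T := by
    intro F hF h0
    have : IntegrableOn F (Icc (0:ℝ) (R + ‖z‖) ×ˢ Icc (-Real.pi) Real.pi) :=
      hF.continuousOn.integrableOn_compact (isCompact_Icc.prod isCompact_Icc)
    exact this.of_forall_sdiff_eq_zero hTm fun p hp => h0 p (hRd _ (hfar p hp))
  have hAi := hIntg A hAc (fun p hp => by simp [hA, hp])
  have hBi := hIntg B hBc (fun p hp => by simp [hB, hp])
  have hvol : (volume.restrict T : Measure (ℝ × ℝ)) =
      (volume.restrict (Ioi (0:ℝ))).prod (volume.restrict (Ioo (-Real.pi) Real.pi)) := by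
    rw [Measure.prod_restrict]; rfl
  have hAint : ∫ p in T, A p = 2 * Real.pi * h z := by
    rw [hvol, integral_prod_symm]
    · have : ∀ θ : ℝ, ∫ r in Ioi (0:ℝ), A (r, θ) = h z := by
        intro θ
        have hd : ∀ r : ℝ, HasDerivAt (fun r : ℝ => h (z - r * eth θ)) (-A (r, θ)) r := by
          intro r
          have h1 : HasDerivAt (fun r : ℝ => z - r * eth θ) (-(eth θ)) r := by
            have := (((hasDerivAt_id r).ofReal_comp).mul_const (eth θ)).const_sub z
            simpa using this
          have := (diffAt hh.smooth (z - r * eth θ)).hasFDerivAt.comp_hasDerivAt r h1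
          simpa [hA, hP, Function.comp_def] using this
        have hfar' : ∀ r : ℝ, R + ‖z‖ < r → R < ‖z - r * eth θ‖ := by
          intro r hr
          have : ‖(r:ℂ) * eth θ‖ ≤ ‖z - r * eth θ‖ + ‖z‖ := by
            have := norm_sub_le z (z - r * eth θ)
            simp only [sub_sub_cancel] at this
            linarith
          have h1 : 0 ≤ r := by have := norm_nonneg z; linarith
          rw [norm_mul, norm_eth, mul_one, Complex.norm_real, Real.norm_of_nonneg h1] at this
          linarith
        have hi : IntegrableOn (fun r : ℝ => -A (r, θ)) (Ioi 0) := by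
          have hc : Continuous (fun r : ℝ => -A (r, θ)) := by fun_prop
          have : IntegrableOn (fun r : ℝ => -A (r, θ)) (Icc 0 (R + ‖z‖)) :=
            hc.continuousOn.integrableOn_compact isCompact_Icc
          refine this.of_forall_sdiff_eq_zero measurableSet_Ioi fun r hr => ?_
          have hr' : R + ‖z‖ < r := by
            obtain ⟨h1, h2⟩ := hr
            simp only [mem_Ioi, mem_Icc, not_and, not_le] at h1 h2
            exact h2 h1.le
          simp [hA, hP, hRd _ (hfar' r hr')]
        have ht : Tendsto (fun r : ℝ => h (z - r * eth θ)) atTop (𝓝 0) := by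
          refine tendsto_const_nhds.congr' ?_
          filter_upwards [eventually_gt_atTop (R + ‖z‖)] with r hr
          exact (hRh _ (hfar' r hr).le).symm
        have := integral_Ioi_of_hasDerivAt_of_tendsto (hd 0).continuousAt.continuousWithinAt
          (fun r _ => hd r) hi ht
        rw [integral_neg] at this
        simpa using this
      simp only [this]
      have hpi := Real.pi_pos
      rw [setIntegral_const]
      simp [Measure.real, hpi.le]; left; ring
    · rw [← hvol]; exact hAi
  have hBint : ∫ p in T, B p = 0 := by
    rw [hvol, integral_prod]
    · have : ∀ r ∈ Ioi (0:ℝ), ∫ θ in Ioo (-Real.pi) Real.pi, B (r, θ) = 0 := by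
        intro r hr
        have hr0 : (r:ℂ) ≠ 0 := by exact_mod_cast (ne_of_gt hr)
        have hd : ∀ θ : ℝ, HasDerivAt (fun θ : ℝ => h (z - r * eth θ)) (-(r * B (r, θ))) θ := by
          intro θ
          have h1 : HasDerivAt (fun θ : ℝ => z - r * eth θ) (-(r • (I * eth θ))) θ := by
            have := ((hasDerivAt_eth θ).const_mul (r:ℂ)).const_sub z
            simpa using this
          have := (diffAt hh.smooth (z - r * eth θ)).hasFDerivAt.comp_hasDerivAt θ h1
          rw [map_neg, map_smul] at this
          simpa [hB, hP, Function.comp_def] using this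
        have hc : Continuous (fun θ : ℝ => -(r * B (r, θ))) := by fun_prop
        have := intervalIntegral.integral_eq_sub_of_hasDerivAt (a := -Real.pi) (b := Real.pi)
          (fun θ _ => hd θ) (hc.intervalIntegrable _ _)
        rw [intervalIntegral.integral_neg, intervalIntegral.integral_const_mul,
          intervalIntegral.integral_of_le (by linarith [Real.pi_pos]),
          integral_Ioc_eq_integral_Ioo] at this
        have e : eth (-Real.pi) = eth Real.pi := by simp [eth]
        rw [e, sub_self, neg_eq_zero, mul_eq_zero] at this
        exact this.resolve_left hr0
      rw [setIntegral_congr_fun measurableSet_Ioi this]; simp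
    · rw [← hvol]; exact hBi
  rw [CT_apply, ← Complex.integral_comp_polarCoord_symm]
  have hpt : polarCoord.target = T := by rw [polarCoord_target]
  rw [hpt]
  have : ∫ p in T, p.1 • (ker (Complex.polarCoord.symm p) * db h (z - Complex.polarCoord.symm p))
      = ∫ p in T, (2 * Real.pi : ℂ)⁻¹ * (A p + I * B p) := by
    refine setIntegral_congr_fun hTm ?_
    rintro ⟨r, θ⟩ ⟨hr, hθ⟩
    have hr0 : (r:ℂ) ≠ 0 := by exact_mod_cast (ne_of_gt hr)
    have hpi : (Real.pi : ℂ) ≠ 0 := by exact_mod_cast Real.pi_ne_zero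
    have he : eth θ ≠ 0 := by
      intro h0; have := norm_eth θ; rw [h0] at this; simp at this
    have hsym : Complex.polarCoord.symm (r, θ) = r * eth θ := by
      rw [Complex.polarCoord_symm_apply]; rfl
    have hcs : ((Real.cos θ : ℝ) : ℂ)^2 + ((Real.sin θ : ℝ) : ℂ)^2 = 1 := by
      exact_mod_cast Real.cos_sq_add_sin_sq θ
    have key : A (r, θ) + I * B (r, θ) = 2 * (eth θ)⁻¹ * db h (z - r * eth θ) := by
      simp only [hA, hB, hP]
      rw [fd_decomp _ (eth θ), fd_decomp _ (I * eth θ)]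
      have h1 : (eth θ)⁻¹ = Real.cos θ - Real.sin θ * I := by
        rw [inv_eq_iff_eq_inv, eq_comm, inv_eq_iff_eq_inv, eq_comm]
        apply inv_eq_of_mul_eq_one_right
        simp only [eth]
        linear_combination hcs - (Real.sin θ : ℂ)^2 * I_sq
      have h2 : (eth θ).re = Real.cos θ := by simp [eth, -Complex.ofReal_cos, -Complex.ofReal_sin]
      have h3 : (eth θ).im = Real.sin θ := by simp [eth, -Complex.ofReal_cos, -Complex.ofReal_sin]
      have h4 : (I * eth θ).re = - Real.sin θ := by simp [h3]
      have h5 : (I * eth θ).im = Real.cos θ := by simp [h2]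
      rw [h1, h2, h3, h4, h5]
      simp only [db, ofReal_neg]
      linear_combination (Real.sin θ : ℂ) * dd I h (z - r * eth θ) * I_sq
    simp only [hsym, key, ker, Complex.real_smul]
    field_simp
  rw [this, integral_const_mul, integral_add hAi (hBi.const_mul I), integral_const_mul, hAint,
    hBint]
  have hpi : (Real.pi : ℂ) ≠ 0 := by exact_mod_cast Real.pi_ne_zero
  field_simp; simp

lemma TF.db_CT' {h : ℂ → ℂ} (hh : TF h) (z : ℂ) : Inv17.db (CT h) z = h z := by
  rw [hh.db_CT, CT_db hh]

end Inv17


namespace Inv17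
open MeasureTheory Complex Set Filter Topology
open scoped ContDiff Convolution

lemma decay_aux {g : ℂ → ℂ} (hg : Continuous g) (k : ℕ) {R M : ℝ}
    (h : ∀ z, R ≤ ‖z‖ → ‖g z‖ * ‖z‖ ^ k ≤ M) :
    ∃ M', ∀ z, ‖g z‖ * (1 + ‖z‖) ^ k ≤ M' := by
  have hc : Continuous (fun z => ‖g z‖ * (1 + ‖z‖) ^ k) := by fun_prop
  obtain ⟨M0, hM0⟩ := (isCompact_closedBall (0:ℂ) (max R 1)).bddAbove_image hc.continuousOn
  refine ⟨max M0 (2 ^ k * M), fun z => ?_⟩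
  by_cases hz : ‖z‖ ≤ max R 1
  · exact (hM0 ⟨z, by simpa using hz, rfl⟩).trans (le_max_left _ _)
  · push Not at hz
    have h1 : R ≤ ‖z‖ := (le_max_left _ _).trans hz.le
    have h2 : 1 ≤ ‖z‖ := (le_max_right _ _).trans hz.le
    refine le_trans ?_ (le_max_right _ _)
    calc ‖g z‖ * (1 + ‖z‖) ^ k ≤ ‖g z‖ * (2 * ‖z‖) ^ k := by gcongr; linarith
      _ = 2 ^ k * (‖g z‖ * ‖z‖ ^ k) := by rw [mul_pow]; ring
      _ ≤ _ := by gcongr; exact h z h1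

lemma TF.decay1 {h : ℂ → ℂ} (hh : TF h) : ∃ M, ∀ z, ‖CT h z‖ * (1 + ‖z‖) ≤ M := by
  obtain ⟨R, hR, hRh⟩ := hh.bound
  have := decay_aux (g := CT h) hh.CT_smooth.continuous 1 (R := 2 * R)
    (M := 2 * Real.pi⁻¹ * ∫ w, ‖h w‖) ?_
  · simpa using this
  intro z hz
  have hz0 : 0 < ‖z‖ := by linarith
  rw [CT_apply', pow_one]
  have : ‖∫ w, ker (z - w) * h w‖ ≤ ∫ w, (2 * Real.pi⁻¹ * ‖z‖⁻¹) * ‖h w‖ := by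
    refine norm_integral_le_of_norm_le (hh.integrable.norm.const_mul _) ?_
    refine Eventually.of_forall fun w => ?_
    by_cases hw : R ≤ ‖w‖
    · simp [hRh w hw]
    · push Not at hw
      rw [norm_mul, norm_ker]
      have h1 : ‖z‖ / 2 ≤ ‖z - w‖ := by
        have := norm_sub_norm_le z w; linarith
      have h2 : ‖z - w‖⁻¹ ≤ 2 * ‖z‖⁻¹ := by
        have := inv_anti₀ (by positivity) h1
        rwa [inv_div, div_eq_mul_inv] at this
      have := Real.pi_pos
      calc Real.pi⁻¹ * ‖z - w‖⁻¹ * ‖h w‖ ≤ Real.pi⁻¹ * (2 * ‖z‖⁻¹) * ‖h w‖ := by gcongr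
        _ = _ := by ring
  rw [integral_const_mul] at this
  calc _ ≤ (2 * Real.pi⁻¹ * ‖z‖⁻¹) * (∫ w, ‖h w‖) * ‖z‖ := by gcongr
    _ = _ := by field_simp

lemma TF.decay2 {h : ℂ → ℂ} (hh : TF h) (h0 : ∫ w, h w = 0) :
    ∃ M, ∀ z, ‖CT h z‖ * (1 + ‖z‖) ^ 2 ≤ M := by
  obtain ⟨R, hR, hRh⟩ := hh.bound
  refine decay_aux (g := CT h) hh.CT_smooth.continuous 2 (R := 2 * R)
    (M := 2 * Real.pi⁻¹ * R * ∫ w, ‖h w‖) ?_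
  intro z hz
  have hz0 : 0 < ‖z‖ := by linarith
  have hzz : z ≠ 0 := norm_pos_iff.1 hz0
  have e : CT h z = ∫ w, (ker (z - w) - ker z) * h w := by
    simp only [sub_mul]
    rw [integral_sub (hh.CT_int' z) (hh.integrable.const_mul _), integral_const_mul, h0,
      ← CT_apply']; simp
  rw [e]
  have : ‖∫ w, (ker (z - w) - ker z) * h w‖ ≤
      ∫ w, (2 * Real.pi⁻¹ * R * (‖z‖⁻¹)^2) * ‖h w‖ := by
    refine norm_integral_le_of_norm_le (hh.integrable.norm.const_mul _) ?_
    refine Eventually.of_forall fun w => ?_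
    by_cases hw : R ≤ ‖w‖
    · simp [hRh w hw]
    · push Not at hw
      have h1 : ‖z‖ / 2 ≤ ‖z - w‖ := by
        have := norm_sub_norm_le z w; linarith
      have hzw : z - w ≠ 0 := by
        rw [← norm_pos_iff]; linarith
      have h2 : ‖z - w‖⁻¹ ≤ 2 * ‖z‖⁻¹ := by
        have := inv_anti₀ (by positivity) h1
        rwa [inv_div, div_eq_mul_inv] at this
      have hpi : (Real.pi : ℂ) ≠ 0 := by exact_mod_cast Real.pi_ne_zero
      have e2 : ker (z - w) - ker z = w * (Real.pi:ℂ)⁻¹ * (z - w)⁻¹ * z⁻¹ := by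
        unfold ker; field_simp; ring
      have := Real.pi_pos
      rw [norm_mul, e2]
      simp only [norm_mul, norm_inv, Complex.norm_real, Real.norm_of_nonneg this.le]
      calc ‖w‖ * Real.pi⁻¹ * ‖z - w‖⁻¹ * ‖z‖⁻¹ * ‖h w‖
          ≤ R * Real.pi⁻¹ * (2 * ‖z‖⁻¹) * ‖z‖⁻¹ * ‖h w‖ := by gcongr
        _ = _ := by ring
  rw [integral_const_mul] at this
  calc _ ≤ (2 * Real.pi⁻¹ * R * (‖z‖⁻¹)^2) * (∫ w, ‖h w‖) * ‖z‖ ^ 2 := by gcongr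
    _ = _ := by field_simp

lemma TF.integral_dd {h : ℂ → ℂ} (hh : TF h) (v : ℂ) : ∫ w, Inv17.dd v h w = 0 := by
  have := integral_bilinear_fderiv_right_eq_neg_left_of_integrable (μ := (volume : Measure ℂ))
    (f := fun _ : ℂ => (1:ℂ)) (g := h) (v := v) (B := ContinuousLinearMap.mul ℝ ℂ)
    (by simp) (by simpa using! (hh.dd v).integrable) (by simpa using hh.integrable)
    (fun x _ => by fun_prop) (fun x _ => diffAt hh.smooth x)
  simpa [Inv17.dd] using this

/-- The antisymmetric form `Im (a b̄)`. -/
noncomputable def BI : ℂ →L[ℝ] ℂ →L[ℝ] ℝ :=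
  (innerSL ℝ).comp (ContinuousLinearMap.mul ℝ ℂ (-I))

lemma BI_apply (a b : ℂ) : BI a b = a.im * b.re - a.re * b.im := by
  simp [BI, Complex.inner]; ring

lemma BI_le (a b : ℂ) : ‖BI a b‖ ≤ ‖a‖ * ‖b‖ := by
  have : BI a b = inner ℝ (-I * a) b := by simp [BI]
  rw [this]
  refine (norm_inner_le_norm _ _).trans ?_
  simp

lemma integrable_decay {F : ℂ → ℝ} (hF : Continuous F) {M : ℝ}
    (h : ∀ z, ‖F z‖ * (1 + ‖z‖) ^ 3 ≤ M) : Integrable F := by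
  have h1 : Integrable (fun z : ℂ => M * (1 + ‖z‖) ^ (-(3:ℝ))) :=
    (integrable_one_add_norm (by simp; norm_num)).const_mul M
  refine h1.mono' hF.aestronglyMeasurable (Eventually.of_forall fun z => ?_)
  have hp : 0 < (1 + ‖z‖) := by positivity
  rw [Real.rpow_neg hp.le, ← div_eq_mul_inv, le_div_iff₀ (by positivity)]
  exact_mod_cast h z

lemma integrable_BI {a b : ℂ → ℂ} (ha : Continuous a) (hb : Continuous b) {M N : ℝ}
    (h1 : ∀ z, ‖a z‖ * (1 + ‖z‖) ≤ M) (h2 : ∀ z, ‖b z‖ * (1 + ‖z‖) ^ 2 ≤ N) :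
    Integrable (fun z => BI (a z) (b z)) := by
  refine integrable_decay (M := M * N) (by fun_prop) fun z => ?_
  have hM : 0 ≤ M := le_trans (by positivity) (h1 0)
  calc ‖BI (a z) (b z)‖ * (1 + ‖z‖) ^ 3 ≤ (‖a z‖ * ‖b z‖) * (1 + ‖z‖) ^ 3 := by
        gcongr; exact BI_le _ _
    _ = (‖a z‖ * (1 + ‖z‖)) * (‖b z‖ * (1 + ‖z‖) ^ 2) := by ring
    _ ≤ M * N := by gcongr; exacts [h1 z, h2 z]

lemma TF.BI_zero {h : ℂ → ℂ} (hh : TF h) :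
    ∫ z, BI (Inv17.dd 1 (CT h) z) (Inv17.dd I (CT h) z) = 0 := by
  have hu := hh.CT_smooth
  obtain ⟨M0, hM0⟩ := hh.decay1
  have d2 : ∀ v, ∃ M, ∀ z, ‖Inv17.dd v (CT h) z‖ * (1 + ‖z‖) ^ 2 ≤ M := by
    intro v; rw [hh.dd_CT]; exact (hh.dd v).decay2 (hh.integral_dd v)
  have d3 : ∀ v w, ∃ M, ∀ z, ‖Inv17.dd v (Inv17.dd w (CT h)) z‖ * (1 + ‖z‖) ^ 2 ≤ M := by
    intro v w; rw [hh.dd_CT, (hh.dd w).dd_CT]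
    exact ((hh.dd w).dd v).decay2 ((hh.dd w).integral_dd v)
  have d1 : ∀ v, ∃ M, ∀ z, ‖Inv17.dd v (CT h) z‖ * (1 + ‖z‖) ≤ M := by
    intro v; rw [hh.dd_CT]; exact (hh.dd v).decay1
  have key : ∀ v w, ∫ z, BI (CT h z) (Inv17.dd v (Inv17.dd w (CT h)) z) =
      - ∫ z, BI (Inv17.dd v (CT h) z) (Inv17.dd w (CT h) z) := by
    intro v w
    obtain ⟨M1, hM1⟩ := d1 v
    obtain ⟨M2, hM2⟩ := d2 w
    obtain ⟨M3, hM3⟩ := d3 v w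
    exact integral_bilinear_fderiv_right_eq_neg_left_of_integrable (μ := (volume : Measure ℂ))
      (f := CT h) (g := Inv17.dd w (CT h)) (v := v) (B := BI)
      (integrable_BI (contDiff_dd hu v).continuous (contDiff_dd hu w).continuous hM1 hM2)
      (integrable_BI hu.continuous (contDiff_dd (contDiff_dd hu w) v).continuous hM0 hM3)
      (integrable_BI hu.continuous (contDiff_dd hu w).continuous hM0 hM2)
      (fun x _ => diffAt hu x) (fun x _ => diffAt (contDiff_dd hu w) x)
  have k1 := key 1 I
  have k2 := key I 1
  rw [dd_comm hu I 1, k1] at k2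
  have e : ∫ z, BI (Inv17.dd I (CT h) z) (Inv17.dd 1 (CT h) z) =
      - ∫ z, BI (Inv17.dd 1 (CT h) z) (Inv17.dd I (CT h) z) := by
    rw [← integral_neg]; congr 1; ext z; simp only [BI_apply]; ring
  rw [e] at k2; linarith

lemma integrable_sq_decay {F : ℂ → ℂ} (hF : Continuous F) {M : ℝ}
    (h : ∀ z, ‖F z‖ * (1 + ‖z‖) ^ 2 ≤ M) : Integrable (fun z => ‖F z‖ ^ 2) := by
  refine integrable_decay (M := M * M) (by fun_prop) fun z => ?_
  have hM : 0 ≤ M := le_trans (by positivity) (h 0)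
  have : ‖F z‖ ^ 2 * (1 + ‖z‖) ^ 3 ≤ (‖F z‖ * (1 + ‖z‖) ^ 2) * (‖F z‖ * (1 + ‖z‖) ^ 2) := by
    have e : (‖F z‖ * (1 + ‖z‖) ^ 2) * (‖F z‖ * (1 + ‖z‖) ^ 2)
      = ‖F z‖ ^ 2 * (1 + ‖z‖) ^ 4 := by ring
    rw [e]; gcongr <;> simp
  rw [norm_pow, norm_norm]
  refine this.trans ?_
  gcongr <;> exact h z

lemma eLpNorm_two_eq {F : ℂ → ℂ} (hi : Integrable (fun z => ‖F z‖ ^ 2)) :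
    eLpNorm F 2 volume = (ENNReal.ofReal (∫ z, ‖F z‖ ^ 2)) ^ (1/2 : ℝ) := by
  rw [eLpNorm_eq_lintegral_rpow_enorm_toReal (by simp) (by simp),
    ofReal_integral_eq_lintegral_ofReal hi (Eventually.of_forall fun z => by positivity)]
  congr 2
  ext z
  rw [ENNReal.ofReal_pow (norm_nonneg _), ofReal_norm]
  simp

/-- The Beurling transform `∂ ∘ CT` is an `L²`-isometry. -/
lemma TF.isometry {h : ℂ → ℂ} (hh : TF h) :
    eLpNorm (Inv17.dz (CT h)) 2 volume = eLpNorm h 2 volume := by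
  have hu := hh.CT_smooth
  obtain ⟨M1, hM1⟩ : ∃ M, ∀ z, ‖Inv17.dd 1 (CT h) z‖ * (1 + ‖z‖) ^ 2 ≤ M := by
    rw [hh.dd_CT]; exact (hh.dd 1).decay2 (hh.integral_dd 1)
  obtain ⟨M2, hM2⟩ : ∃ M, ∀ z, ‖Inv17.dd I (CT h) z‖ * (1 + ‖z‖) ^ 2 ≤ M := by
    rw [hh.dd_CT]; exact (hh.dd I).decay2 (hh.integral_dd I)
  have hz : ∀ z, ‖Inv17.dz (CT h) z‖ * (1 + ‖z‖) ^ 2 ≤ M1 + M2 := by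
    intro z
    have h1 := hM1 z
    have h2 := hM2 z
    have : ‖Inv17.dz (CT h) z‖ ≤ ‖Inv17.dd 1 (CT h) z‖ + ‖Inv17.dd I (CT h) z‖ := by
      unfold Inv17.dz
      rw [norm_div]
      have := norm_sub_le (Inv17.dd 1 (CT h) z) (I * Inv17.dd I (CT h) z)
      rw [norm_mul, norm_I, one_mul] at this
      rw [div_le_iff₀ (by simp)]
      have n1 := norm_nonneg (Inv17.dd 1 (CT h) z)
      have n2 := norm_nonneg (Inv17.dd I (CT h) z)
      simp only [Complex.norm_ofNat]; linarith
    calc _ ≤ (‖Inv17.dd 1 (CT h) z‖ + ‖Inv17.dd I (CT h) z‖) * (1 + ‖z‖) ^ 2 := by gcongr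
      _ ≤ _ := by linarith
  have hzi := integrable_sq_decay (contDiff_dz hu).continuous hz
  have hhi : Integrable (fun z => ‖h z‖ ^ 2) := by
    have hcs : HasCompactSupport (fun z => ‖h z‖ ^ 2) := by
      refine hh.supp.mono fun z hz => ?_
      rw [Function.mem_support] at hz ⊢
      intro h0; apply hz; rw [h0]; simp
    have hcc : Continuous (fun z => ‖h z‖ ^ 2) := hh.cont.norm.pow 2
    exact hcc.integrable_of_hasCompactSupport hcs
  rw [eLpNorm_two_eq hzi, eLpNorm_two_eq hhi]
  suffices hs : ∫ z, ‖Inv17.dz (CT h) z‖ ^ 2 = ∫ z, ‖h z‖ ^ 2 by rw [hs]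
  have hBI := hh.BI_zero
  rw [← sub_eq_zero, ← integral_sub hzi hhi]
  have : ∀ z, ‖Inv17.dz (CT h) z‖ ^ 2 - ‖h z‖ ^ 2 =
      -(BI (Inv17.dd 1 (CT h) z) (Inv17.dd I (CT h) z)) := by
    intro z
    rw [← hh.db_CT' z, Complex.sq_norm, Complex.sq_norm, BI_apply]
    simp only [Inv17.dz, Inv17.db, Complex.normSq_apply, Complex.div_ofNat_re,
      Complex.div_ofNat_im, Complex.sub_re, Complex.sub_im, Complex.add_re, Complex.add_im,
      Complex.mul_re, Complex.mul_im, Complex.I_re, Complex.I_im]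
    ring
  simp only [this, integral_neg, hBI, neg_zero]

end Inv17


namespace Inv17
open MeasureTheory Complex Set Filter Topology
open scoped ContDiff Convolution

/-- Real-valued `L²` norm. -/
noncomputable def l2 (f : ℂ → ℂ) : ℝ := (eLpNorm f 2 volume).toReal

lemma l2_nonneg (f : ℂ → ℂ) : 0 ≤ l2 f := ENNReal.toReal_nonneg

lemma l2_add {f g : ℂ → ℂ} (hf : MemLp f 2 volume) (hg : MemLp g 2 volume) :
    l2 (fun z => f z + g z) ≤ l2 f + l2 g := by
  unfold l2
  rw [← ENNReal.toReal_add hf.2.ne hg.2.ne]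
  refine ENNReal.toReal_mono (ENNReal.add_ne_top.2 ⟨hf.2.ne, hg.2.ne⟩) ?_
  exact eLpNorm_add_le hf.1 hg.1 (by norm_num)

lemma eLp_mul {c f : ℂ → ℂ} {k : ℝ} (hk : ∀ z, ‖c z‖ ≤ k) :
    eLpNorm (fun z => c z * f z) 2 volume ≤ ENNReal.ofReal k * eLpNorm f 2 volume := by
  refine eLpNorm_le_mul_eLpNorm_of_ae_le_mul (Eventually.of_forall fun z => ?_) 2
  rw [norm_mul]; gcongr; exact hk z

lemma memLp_mul {c f : ℂ → ℂ} {k : ℝ} (hk : ∀ z, ‖c z‖ ≤ k) (hc : Continuous c)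
    (hf : MemLp f 2 volume) : MemLp (fun z => c z * f z) 2 volume :=
  ⟨hc.aestronglyMeasurable.mul hf.1,
    (eLp_mul hk).trans_lt (ENNReal.mul_lt_top ENNReal.ofReal_lt_top hf.2)⟩

lemma l2_mul {c f : ℂ → ℂ} {k : ℝ} (hk : ∀ z, ‖c z‖ ≤ k) (hf : MemLp f 2 volume) :
    l2 (fun z => c z * f z) ≤ k * l2 f := by
  have hk0 : 0 ≤ k := (norm_nonneg _).trans (hk 0)
  unfold l2
  have := ENNReal.toReal_mono (ENNReal.mul_lt_top ENNReal.ofReal_lt_top hf.2).ne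
    (eLp_mul (f := f) hk)
  rwa [ENNReal.toReal_mul, ENNReal.toReal_ofReal hk0] at this

lemma TF.memLp {f : ℂ → ℂ} (hf : TF f) : MemLp f 2 volume :=
  hf.cont.memLp_of_hasCompactSupport hf.supp

/-- The Beurling transform. -/
noncomputable def BT (h : ℂ → ℂ) : ℂ → ℂ := dz (CT h)

lemma TF.BT_smooth {h : ℂ → ℂ} (hh : TF h) : ContDiff ℝ ∞ (BT h) := contDiff_dz hh.CT_smooth

lemma TF.BT_dd {h : ℂ → ℂ} (hh : TF h) (v : ℂ) : Inv17.dd v (BT h) = BT (Inv17.dd v h) := by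
  unfold BT; rw [dd_dz hh.CT_smooth, hh.dd_CT]

lemma TF.BT_memLp {h : ℂ → ℂ} (hh : TF h) : MemLp (BT h) 2 volume :=
  ⟨hh.BT_smooth.continuous.aestronglyMeasurable, by
    unfold BT; rw [hh.isometry]; exact hh.memLp.2⟩

lemma TF.l2_BT {h : ℂ → ℂ} (hh : TF h) : l2 (BT h) = l2 h := by
  unfold l2 BT; rw [hh.isometry]

/-- Summability in the Sobolev space of order `m`. -/
def Good : ℕ → (ℕ → ℂ → ℂ) → Prop
  | 0, s => (∀ n, MemLp (s n) 2 volume) ∧ Summable fun n => l2 (s n)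
  | m + 1, s => Good m s ∧ ∀ v, Good m fun n => dd v (s n)

lemma Good.add {m : ℕ} {s t : ℕ → ℂ → ℂ} (hs : ∀ n, ContDiff ℝ ∞ (s n))
    (ht : ∀ n, ContDiff ℝ ∞ (t n)) (h1 : Good m s) (h2 : Good m t) :
    Good m fun n z => s n z + t n z := by
  induction m generalizing s t with
  | zero =>
    refine ⟨fun n => (h1.1 n).add (h2.1 n), ?_⟩
    exact Summable.of_nonneg_of_le (fun n => l2_nonneg _) (fun n => l2_add (h1.1 n) (h2.1 n))
      (h1.2.add h2.2)
  | succ m ih =>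
    refine ⟨ih hs ht h1.1 h2.1, fun v => ?_⟩
    have := ih (fun n => contDiff_dd (hs n) v) (fun n => contDiff_dd (ht n) v) (h1.2 v) (h2.2 v)
    convert this using 2 with n
    ext z; exact dd_add (hs n) (ht n) v z

lemma TF.bdd {c : ℂ → ℂ} (hc : TF c) : ∃ k, ∀ z, ‖c z‖ ≤ k := by
  obtain ⟨k, hk⟩ := hc.supp.exists_bound_of_continuous hc.cont
  exact ⟨k, hk⟩

lemma Good.mul {m : ℕ} {s : ℕ → ℂ → ℂ} (hs : ∀ n, ContDiff ℝ ∞ (s n)) {c : ℂ → ℂ} (hc : TF c)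
    (h : Good m s) : Good m fun n z => c z * s n z := by
  induction m generalizing s c with
  | zero =>
    obtain ⟨k, hk⟩ := hc.bdd
    refine ⟨fun n => memLp_mul hk hc.cont (h.1 n), ?_⟩
    exact Summable.of_nonneg_of_le (fun n => l2_nonneg _) (fun n => l2_mul hk (h.1 n))
      (h.2.mul_left k)
  | succ m ih =>
    refine ⟨ih hs hc h.1, fun v => ?_⟩
    have h1 := ih hs (hc.dd v) h.1
    have h2 := ih (fun n => contDiff_dd (hs n) v) hc (h.2 v)
    have := h1.add (fun n => (hc.dd v).smooth.mul (hs n))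
      (fun n => hc.smooth.mul (contDiff_dd (hs n) v)) h2
    convert this using 2 with n
    ext z; exact dd_mul hc.smooth (hs n) v z

lemma Good.BT {m : ℕ} {s : ℕ → ℂ → ℂ} (hs : ∀ n, TF (s n)) (h : Good m s) :
    Good m fun n => BT (s n) := by
  induction m generalizing s with
  | zero =>
    refine ⟨fun n => (hs n).BT_memLp, ?_⟩
    simp only [(hs _).l2_BT]; exact h.2
  | succ m ih =>
    refine ⟨ih hs h.1, fun v => ?_⟩
    have := ih (fun n => (hs n).dd v) (h.2 v)
    simpa only [(hs _).BT_dd] using this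

lemma summable_gronwall {a e : ℕ → ℝ} {k : ℝ} (hk : k < 1) (ha : ∀ n, 0 ≤ a n)
    (he0 : ∀ n, 0 ≤ e n) (he : Summable e) (h : ∀ n, a (n + 1) ≤ k * a n + e n) : Summable a := by
  refine summable_of_sum_range_le (c := (a 0 + ∑' n, e n) / (1 - k)) ha fun N => ?_
  rw [le_div_iff₀ (by linarith)]
  have h1 : ∑ n ∈ Finset.range N, a n ≤ ∑ n ∈ Finset.range (N + 1), a n := by
    rw [Finset.sum_range_succ]; linarith [ha N]
  rw [Finset.sum_range_succ'] at h1
  have h2 : ∑ n ∈ Finset.range N, a (n + 1) ≤ k * ∑ n ∈ Finset.range N, a n +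
      ∑ n ∈ Finset.range N, e n := by
    rw [Finset.mul_sum, ← Finset.sum_add_distrib]
    exact Finset.sum_le_sum fun n _ => h n
  have h3 := he.sum_le_tsum (Finset.range N) (fun n _ => he0 n)
  linarith

lemma Good.step {m : ℕ} {μ : ℂ → ℂ} (hμ : TF μ) {k : ℝ} (hk : k < 1) (hμk : ∀ z, ‖μ z‖ ≤ k)
    {s r : ℕ → ℂ → ℂ} (hs : ∀ n, TF (s n)) (hr : ∀ n, ContDiff ℝ ∞ (r n)) (hg : Good m r)
    (h : ∀ n, s (n + 1) = fun z => μ z * Inv17.BT (s n) z + r n z) : Good m s := by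
  induction m generalizing s r with
  | zero =>
    refine ⟨fun n => (hs n).memLp, ?_⟩
    refine summable_gronwall hk (fun n => l2_nonneg _) (fun n => l2_nonneg _) hg.2 fun n => ?_
    rw [h n]
    refine (l2_add (memLp_mul hμk hμ.cont (hs n).BT_memLp) (hg.1 n)).trans ?_
    gcongr
    rw [← (hs n).l2_BT]
    exact l2_mul hμk (hs n).BT_memLp
  | succ m ih =>
    have hm := ih hs hr hg.1 h
    refine ⟨hm, fun v => ?_⟩
    refine ih (r := fun n z => dd v μ z * Inv17.BT (s n) z + dd v (r n) z)
      (fun n => (hs n).dd v) (fun n => ((hμ.dd v).smooth.mul (hs n).BT_smooth).add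
        (contDiff_dd (hr n) v)) ?_ ?_
    · exact ((hm.BT hs).mul (fun n => (hs n).BT_smooth) (hμ.dd v)).add
        (fun n => (hμ.dd v).smooth.mul (hs n).BT_smooth) (fun n => contDiff_dd (hr n) v) (hg.2 v)
    · intro n
      ext z
      rw [h n, dd_add (hμ.smooth.mul (hs n).BT_smooth) (hr n), dd_mul hμ.smooth (hs n).BT_smooth,
        (hs n).BT_dd]
      ring

lemma norm_le_integral_deriv {g g' : ℝ → ℂ} (hg : ∀ x, HasDerivAt g (g' x) x)
    (hg' : Continuous g') (hc : HasCompactSupport g) (x : ℝ) : ‖g x‖ ≤ ∫ t, ‖g' t‖ := by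
  have hgd : deriv g = g' := funext fun x => (hg x).deriv
  have hg1 : ContDiff ℝ 1 g := by
    rw [contDiff_one_iff_deriv]
    exact ⟨fun x => (hg x).differentiableAt, by rw [hgd]; exact hg'⟩
  have h1 := hc.integral_Iic_deriv_eq hg1 x
  have hi : Integrable g' := by
    rw [← hgd] at hg' ⊢
    exact hg'.integrable_of_hasCompactSupport hc.deriv
  rw [← h1, hgd]
  refine (norm_integral_le_integral_norm _).trans ?_
  exact setIntegral_le_integral hi.norm (Eventually.of_forall fun t => norm_nonneg _)

lemma TF.line {h : ℂ → ℂ} (hh : TF h) (z v : ℂ) (hv : v ≠ 0) :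
    ‖h z‖ ≤ ∫ t : ℝ, ‖Inv17.dd v h (z + t * v)‖ := by
  have hd : ∀ t : ℝ, HasDerivAt (fun t : ℝ => h (z + t * v)) (Inv17.dd v h (z + t * v)) t := by
    intro t
    have h1 : HasDerivAt (fun t : ℝ => z + t * v) v t := by
      simpa using (((hasDerivAt_id t).ofReal_comp).mul_const v).const_add z
    have := (diffAt hh.smooth (z + t * v)).hasFDerivAt.comp_hasDerivAt t h1
    simpa [Inv17.dd, Function.comp_def] using this
  have hc : HasCompactSupport (fun t : ℝ => h (z + t * v)) := by
    obtain ⟨R, hR, hRh⟩ := hh.bound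
    refine HasCompactSupport.of_support_subset_isCompact
      (K := Icc (-((R + ‖z‖) / ‖v‖)) ((R + ‖z‖) / ‖v‖)) isCompact_Icc ?_
    intro t ht
    by_contra hcon
    apply ht
    apply hRh
    have hv0 : 0 < ‖v‖ := norm_pos_iff.2 hv
    have : (R + ‖z‖) / ‖v‖ < |t| := by
      rw [mem_Icc, ← abs_le] at hcon; exact not_le.1 hcon
    rw [div_lt_iff₀ hv0] at this
    have h2 : ‖(t:ℂ) * v‖ ≤ ‖z + t * v‖ + ‖z‖ := by
      have := norm_sub_le (z + t * v) z
      simpa using this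
    rw [norm_mul, Complex.norm_real, Real.norm_eq_abs] at h2
    linarith
  have hcont : Continuous (fun t : ℝ => Inv17.dd v h (z + t * v)) :=
    (hh.dd v).cont.comp (by fun_prop)
  have := norm_le_integral_deriv hd hcont hc 0
  simpa using this

lemma TF.sup_le_L1 {h : ℂ → ℂ} (hh : TF h) (z : ℂ) :
    ‖h z‖ ≤ ∫ w, ‖Inv17.dd I (Inv17.dd 1 h) w‖ := by
  set D := Inv17.dd I (Inv17.dd 1 h) with hD
  have hDi : Integrable (fun w => ‖D w‖) := ((hh.dd 1).dd I).integrable.norm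
  have hmp := Complex.volume_preserving_equiv_real_prod.symm
  have hemb := measurableEquivRealProd.symm.measurableEmbedding
  have hi2 : Integrable (fun p : ℝ × ℝ => ‖D (measurableEquivRealProd.symm p)‖) :=
    (hmp.integrable_comp_emb hemb).2 hDi
  rw [← hmp.integral_comp hemb, Measure.volume_eq_prod, integral_prod _ hi2]
  refine (hh.line z 1 one_ne_zero).trans ?_
  have key : ∀ x y : ℝ, ‖Inv17.dd 1 h (x + y * I)‖ ≤
      ∫ s : ℝ, ‖D (measurableEquivRealProd.symm (x, s))‖ := by
    intro x y
    have := (hh.dd 1).line (x + y * I) I I_ne_zero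
    have e : ∀ s : ℝ, (x + y * I + s * I : ℂ) = measurableEquivRealProd.symm (x, s + y) := by
      intro s
      apply Complex.ext <;> simp [measurableEquivRealProd_symm_apply, add_comm]
    simp only [e] at this
    refine this.trans (le_of_eq ?_)
    exact integral_add_right_eq_self (fun s => ‖D (measurableEquivRealProd.symm (x, s))‖) y
  have hx : ∫ t : ℝ, ‖Inv17.dd 1 h (z + t * 1)‖ =
      ∫ t : ℝ, ‖Inv17.dd 1 h (t + z.im * I)‖ := by
    rw [← integral_add_right_eq_self (fun t : ℝ => ‖Inv17.dd 1 h (t + z.im * I)‖) z.re]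
    congr 1; ext t; congr 2
    apply Complex.ext <;> simp [add_comm]
  rw [hx]
  refine integral_mono_of_nonneg (Eventually.of_forall fun t => norm_nonneg _)
    hi2.integral_prod_left (Eventually.of_forall fun t => ?_)
  exact key t z.im

lemma TF.L1_le_l2 {D : ℂ → ℂ} (hD : TF D) {R : ℝ} (hR : tsupport D ⊆ Metric.closedBall 0 R) :
    ∫ w, ‖D w‖ ≤ l2 D * ((volume (Metric.closedBall (0:ℂ) R)).toReal ^ (1/2 : ℝ)) := by
  set S := Metric.closedBall (0:ℂ) R
  have hSf : volume S ≠ ⊤ := (isCompact_closedBall (0:ℂ) R).measure_lt_top.ne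
  have h1 : ∫ w, ‖D w‖ = ∫ w in S, ‖D w‖ := by
    rw [setIntegral_eq_integral_of_forall_compl_eq_zero]
    intro w hw
    rw [image_eq_zero_of_notMem_tsupport (fun h => hw (hR h))]; simp
  rw [h1, integral_norm_eq_lintegral_enorm hD.cont.aestronglyMeasurable]
  have h2 := eLpNorm_le_eLpNorm_mul_rpow_measure_univ (p := 1) (q := 2) (by norm_num)
    (μ := volume.restrict S) (f := D) hD.cont.aestronglyMeasurable
  rw [eLpNorm_one_eq_lintegral_enorm, Measure.restrict_apply_univ] at h2
  have h3 : eLpNorm D 2 (volume.restrict S) ≤ eLpNorm D 2 volume :=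
    eLpNorm_mono_measure _ Measure.restrict_le_self
  have h4 : ∫⁻ w in S, ‖D w‖ₑ ≤ eLpNorm D 2 volume * volume S ^ (1/2 : ℝ) := by
    refine h2.trans ?_
    have : (1 / ENNReal.toReal 1 - 1 / ENNReal.toReal 2 : ℝ) = 1/2 := by
      simp; norm_num
    rw [this]
    gcongr
  have := ENNReal.toReal_mono (ENNReal.mul_ne_top hD.memLp.2.ne
    (ENNReal.rpow_ne_top_of_nonneg (by norm_num) hSf)) h4
  rwa [ENNReal.toReal_mul, ← ENNReal.toReal_rpow] at this

/-- Uniform summability of derivatives up to order `m`. -/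
def GS : ℕ → (ℕ → ℂ → ℂ) → Prop
  | 0, s => ∃ u : ℕ → ℝ, Summable u ∧ ∀ n z, ‖s n z‖ ≤ u n
  | m + 1, s => (∃ u : ℕ → ℝ, Summable u ∧ ∀ n z, ‖s n z‖ ≤ u n) ∧ ∀ v, GS m fun n => dd v (s n)

lemma Good.sup {m : ℕ} {s : ℕ → ℂ → ℂ} (hs : ∀ n, TF (s n)) {R : ℝ}
    (hR : ∀ n, tsupport (s n) ⊆ Metric.closedBall 0 R) (h : Good (m + 2) s) : GS m s := by
  have base : ∀ {t : ℕ → ℂ → ℂ}, (∀ n, TF (t n)) →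
      (∀ n, tsupport (t n) ⊆ Metric.closedBall 0 R) → Good 2 t → GS 0 t := by
    intro t ht hRt hg
    have h1 : Good 0 fun n => dd I (dd 1 (t n)) := (hg.2 1).2 I
    refine ⟨fun n => l2 (dd I (dd 1 (t n))) *
      ((volume (Metric.closedBall (0:ℂ) R)).toReal ^ (1/2 : ℝ)), h1.2.mul_right _, fun n z => ?_⟩
    refine ((ht n).sup_le_L1 z).trans ((((ht n).dd 1).dd I).L1_le_l2 ?_)
    exact (tsupport_fderiv_apply_subset ℝ I).trans
      ((tsupport_fderiv_apply_subset ℝ 1).trans (hRt n))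
  have low : ∀ m, ∀ {t : ℕ → ℂ → ℂ}, Good (m + 2) t → Good 2 t := by
    intro m
    induction m with
    | zero => intro t h; exact h
    | succ m ih => intro t h; exact ih h.1
  induction m generalizing s with
  | zero => exact base hs hR h
  | succ m ih =>
    refine ⟨base hs hR (low _ h), fun v => ?_⟩
    exact ih (fun n => (hs n).dd v)
      (fun n => (tsupport_fderiv_apply_subset ℝ v).trans (hR n)) (h.2 v)

lemma GS.zero {m : ℕ} {s : ℕ → ℂ → ℂ} (h : GS m s) : GS 0 s := by
  cases m with
  | zero => exact h
  | succ m => exact h.1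

lemma GS.summable {m : ℕ} {s : ℕ → ℂ → ℂ} (h : GS m s) (z : ℂ) : Summable fun n => s n z := by
  obtain ⟨u, hu, hb⟩ := h.zero
  exact Summable.of_norm_bounded hu fun n => hb n z

lemma fderiv_eq_sum (f : ℂ → ℂ) (z : ℂ) : fderiv ℝ f z =
    reCLM.smulRight (dd 1 f z) + imCLM.smulRight (dd I f z) := by
  refine ContinuousLinearMap.ext fun v => ?_
  rw [fd_decomp]; simp

lemma GS.hasFDerivAt {s : ℕ → ℂ → ℂ} (hs : ∀ n, ContDiff ℝ ∞ (s n)) (h : GS 1 s) (z : ℂ) :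
    HasFDerivAt (fun z => ∑' n, s n z) (reCLM.smulRight (∑' n, dd 1 (s n) z) +
      imCLM.smulRight (∑' n, dd I (s n) z)) z := by
  obtain ⟨u1, hu1, hb1⟩ := h.2 1
  obtain ⟨u2, hu2, hb2⟩ := h.2 I
  have key := hasFDerivAt_tsum (𝕜 := ℝ) (u := fun n => u1 n + u2 n) (f := s)
    (f' := fun n z => fderiv ℝ (s n) z) (hu1.add hu2)
    (fun n x => (diffAt (hs n) x).hasFDerivAt) (fun n x => ?_) (h.summable 0) z
  · convert! key using 1
    simp only [fderiv_eq_sum (s _)]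
    have s1 : Summable fun n => dd 1 (s n) z := (h.2 1).summable z
    have s2 : Summable fun n => dd I (s n) z := (h.2 I).summable z
    have a1 := ((ContinuousLinearMap.smulRightL ℝ ℂ ℂ) reCLM).hasSum s1.hasSum
    have a2 := ((ContinuousLinearMap.smulRightL ℝ ℂ ℂ) imCLM).hasSum s2.hasSum
    exact (a1.add a2).tsum_eq.symm
  · rw [fderiv_eq_sum]
    refine (norm_add_le _ _).trans ?_
    rw [ContinuousLinearMap.norm_smulRight_apply, ContinuousLinearMap.norm_smulRight_apply]
    simp only [Complex.reCLM_norm, Complex.imCLM_norm, one_mul]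
    gcongr
    exacts [hb1 n x, hb2 n x]

lemma GS.dd_tsum {s : ℕ → ℂ → ℂ} (hs : ∀ n, ContDiff ℝ ∞ (s n)) (h : GS 1 s) (v z : ℂ) :
    dd v (fun z => ∑' n, s n z) z = v.re * (∑' n, dd 1 (s n) z) + v.im * ∑' n, dd I (s n) z := by
  unfold dd; rw [(h.hasFDerivAt hs z).fderiv]; simp [dd]

lemma GS.contDiff {m : ℕ} {s : ℕ → ℂ → ℂ} (hs : ∀ n, ContDiff ℝ ∞ (s n)) (h : GS (m + 1) s) :
    ContDiff ℝ m (fun z => ∑' n, s n z) := by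
  induction m generalizing s with
  | zero =>
    simp only [Nat.cast_zero, contDiff_zero]
    exact continuous_iff_continuousAt.2 fun z => (h.hasFDerivAt hs z).continuousAt
  | succ m ih =>
    have h1 : GS 1 s := ⟨h.1, fun v => (h.2 v).zero⟩
    rw [show ((m + 1 : ℕ) : WithTop ℕ∞) = (m : WithTop ℕ∞) + 1 by simp,
      contDiff_succ_iff_hasFDerivAt]
    refine ⟨_, ?_, fun z => h1.hasFDerivAt hs z⟩
    have i1 := ih (fun n => contDiff_dd (hs n) 1) (h.2 1)
    have i2 := ih (fun n => contDiff_dd (hs n) I) (h.2 I)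
    exact (contDiff_const.smulRight i1).add (contDiff_const.smulRight i2)

end Inv17


namespace Inv17
open MeasureTheory Complex Set Filter Topology
open scoped ContDiff Convolution

lemma CT_tsum {s : ℕ → ℂ → ℂ} (hs : ∀ n, TF (s n)) {R : ℝ}
    (hR : ∀ n, tsupport (s n) ⊆ Metric.closedBall 0 R) {u : ℕ → ℝ} (hu : Summable u)
    (hb : ∀ n z, ‖s n z‖ ≤ u n) (z : ℂ) :
    HasSum (fun n => CT (s n) z) (CT (fun w => ∑' n, s n w) z) := by
  have hsum : ∀ w, Summable fun n => s n w := fun w =>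
    Summable.of_norm_bounded hu fun n => hb n w
  simp only [CT_apply']
  have e : (fun w => ker (z - w) * ∑' n, s n w) = fun w => ∑' n, ker (z - w) * s n w := by
    ext w; rw [tsum_mul_left]
  rw [e]
  have hK : IntegrableOn (fun w => ‖ker (z - w)‖) (Metric.closedBall 0 R) := by
    have h1 : IntegrableOn ker (Metric.closedBall z R) :=
      ker_locInt.integrableOn_isCompact (isCompact_closedBall z R)
    have h2 := ((integrable_indicator_iff measurableSet_closedBall).2 h1).comp_sub_left z
    rw [← integrable_indicator_iff measurableSet_closedBall]
    refine h2.norm.congr (Eventually.of_forall fun w => ?_)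
    by_cases hw : w ∈ Metric.closedBall (0:ℂ) R
    · have : z - w ∈ Metric.closedBall z R := by simpa using hw
      simp only [indicator_of_mem hw, indicator_of_mem this]
    · have : z - w ∉ Metric.closedBall z R := by simpa using hw
      simp only [indicator_of_notMem hw, indicator_of_notMem this, norm_zero]
  refine hasSum_integral_of_summable_integral_norm (fun n => (hs n).CT_int' z) ?_
  refine Summable.of_nonneg_of_le (fun n => by positivity) (fun n => ?_)
    (hu.mul_right (∫ w in Metric.closedBall 0 R, ‖ker (z - w)‖))
  rw [← integral_indicator measurableSet_closedBall, ← integral_const_mul]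
  refine integral_mono ((hs n).CT_int' z).norm
    (((integrable_indicator_iff measurableSet_closedBall).2 hK).const_mul _) fun w => ?_
  by_cases hw : w ∈ Metric.closedBall (0:ℂ) R
  · simp only [indicator_of_mem hw, norm_mul]
    rw [mul_comm]; gcongr; exact hb n w
  · simp only [indicator_of_notMem hw, mul_zero]
    rw [image_eq_zero_of_notMem_tsupport (fun h => hw (hR n h))]; simp

lemma tsupport_dd (v : ℂ) (f : ℂ → ℂ) : tsupport (dd v f) ⊆ tsupport f :=
  tsupport_fderiv_apply_subset ℝ v

lemma dz_zero_off {f : ℂ → ℂ} {z : ℂ} (h : z ∉ tsupport f) : dz f z = 0 := by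
  have h1 := image_eq_zero_of_notMem_tsupport (fun h' => h (tsupport_dd 1 f h'))
  have h2 := image_eq_zero_of_notMem_tsupport (fun h' => h (tsupport_dd I f h'))
  simp [dz, h1, h2]

lemma tsupport_dz (f : ℂ → ℂ) : tsupport (dz f) ⊆ tsupport f := by
  refine closure_minimal (fun z hz => ?_) (isClosed_tsupport f)
  by_contra h
  exact hz (dz_zero_off h)

/-- The Neumann series for the Beltrami equation. -/
noncomputable def hser (μ : ℂ → ℂ) : ℕ → ℂ → ℂ
  | 0 => dz μ
  | n + 1 => fun z => μ z * BT (hser μ n) z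

lemma hser_TF {μ : ℂ → ℂ} (hμ : TF μ) (n : ℕ) : TF (hser μ n) := by
  induction n with
  | zero => exact hμ.dz
  | succ n ih => exact hμ.mulc ih.BT_smooth

lemma hser_supp (μ : ℂ → ℂ) (n : ℕ) : tsupport (hser μ n) ⊆ tsupport μ := by
  cases n with
  | zero => exact tsupport_dz μ
  | succ n => exact tsupport_mul_subset_left

lemma hser_GS {μ : ℂ → ℂ} (hμ : TF μ) {k : ℝ} (hk : k < 1) (hμk : ∀ z, ‖μ z‖ ≤ k) (m : ℕ) :
    GS m (hser μ) := by
  obtain ⟨R, hR⟩ := hμ.supp.isCompact.isBounded.subset_closedBall 0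
  refine Good.sup (hser_TF hμ) (R := R) (fun n => (hser_supp μ n).trans hR) ?_
  refine Good.step hμ hk hμk (r := fun _ _ => 0) (hser_TF hμ) (fun _ => contDiff_const) ?_ ?_
  · have : ∀ j, Good j (fun _ _ => 0) := by
      intro j
      induction j with
      | zero =>
        refine ⟨fun n => MemLp.zero', ?_⟩
        have : l2 (fun _ => 0) = 0 := by simp [l2]
        simp only [this]; exact summable_zero
      | succ j ih =>
        refine ⟨ih, fun v => ?_⟩
        convert ih using 3
        exact dd_const 0 v _
    exact this _
  · intro n; ext z; simp [hser]

/-- Solution of the integral equation. -/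
noncomputable def gsol (μ : ℂ → ℂ) (z : ℂ) : ℂ := ∑' n, hser μ n z

lemma gsol_TF {μ : ℂ → ℂ} (hμ : TF μ) {k : ℝ} (hk : k < 1) (hμk : ∀ z, ‖μ z‖ ≤ k) :
    TF (gsol μ) := by
  refine ⟨contDiff_infty.2 fun m =>
    GS.contDiff (fun n => (hser_TF hμ n).smooth) (hser_GS hμ hk hμk (m + 1)), ?_⟩
  refine HasCompactSupport.of_support_subset_isCompact hμ.supp.isCompact fun z hz => ?_
  by_contra h
  apply hz
  unfold gsol
  have : ∀ n, hser μ n z = 0 := fun n =>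
    image_eq_zero_of_notMem_tsupport (fun h' => h (hser_supp μ n h'))
  simp [this]

lemma gsol_eq {μ : ℂ → ℂ} (hμ : TF μ) {k : ℝ} (hk : k < 1) (hμk : ∀ z, ‖μ z‖ ≤ k) (z : ℂ) :
    gsol μ z = dz μ z + μ z * BT (gsol μ) z := by
  have hG := hser_GS hμ hk hμk 1
  obtain ⟨R, hR⟩ := hμ.supp.isCompact.isBounded.subset_closedBall 0
  have hdz : dz (gsol μ) = fun w => ∑' n, dz (hser μ n) w := by
    ext w
    have h1 := hG.dd_tsum (fun n => (hser_TF hμ n).smooth) 1 w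
    have h2 := hG.dd_tsum (fun n => (hser_TF hμ n).smooth) I w
    have s1 : Summable fun n => dd 1 (hser μ n) w := GS.summable (hG.2 1) w
    have s2 : Summable fun n => dd I (hser μ n) w := GS.summable (hG.2 I) w
    have := ((s1.hasSum.sub (s2.hasSum.mul_left I)).div_const 2).tsum_eq
    unfold dz
    rw [this]
    change (dd 1 (fun z => ∑' n, hser μ n z) w - I * dd I (fun z => ∑' n, hser μ n z) w) / 2 = _
    rw [h1, h2]; simp
  have hBT : HasSum (fun n => BT (hser μ n) z) (BT (gsol μ) z) := by
    unfold BT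
    rw [(gsol_TF hμ hk hμk).dz_CT, hdz]
    simp only [(hser_TF hμ _).dz_CT]
    obtain ⟨u1, hu1, hb1⟩ := hG.2 1
    obtain ⟨u2, hu2, hb2⟩ := hG.2 I
    refine CT_tsum (fun n => (hser_TF hμ n).dz) (R := R)
      (fun n => (tsupport_dz _).trans ((hser_supp μ n).trans hR))
      ((hu1.add hu2).div_const 2) (fun n w => ?_) z
    unfold dz
    rw [norm_div]
    have h1 : ‖dd 1 (hser μ n) w - I * dd I (hser μ n) w‖ ≤ u1 n + u2 n := by
      refine (norm_sub_le _ _).trans (add_le_add (hb1 n w) ?_)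
      rw [norm_mul]; simpa using hb2 n w
    simpa using div_le_div_of_nonneg_right h1 (by norm_num : (0:ℝ) ≤ 2)
  have h3 := (GS.summable hG z).tsum_eq_zero_add
  change gsol μ z = _ at h3
  rw [h3]
  congr 1
  exact (hBT.mul_left (μ z)).tsum_eq

lemma dd_cexp {l : ℂ → ℂ} (hl : ContDiff ℝ ∞ l) (v z : ℂ) :
    dd v (fun z => cexp (l z)) z = cexp (l z) * dd v l z := by
  unfold dd; rw [((diffAt hl z).hasFDerivAt.cexp).fderiv]; simp

lemma dz_cexp {l : ℂ → ℂ} (hl : ContDiff ℝ ∞ l) (z : ℂ) :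
    dz (fun z => cexp (l z)) z = cexp (l z) * dz l z := by
  unfold dz; rw [dd_cexp hl, dd_cexp hl]; ring

lemma db_cexp {l : ℂ → ℂ} (hl : ContDiff ℝ ∞ l) (z : ℂ) :
    db (fun z => cexp (l z)) z = cexp (l z) * db l z := by
  unfold db; rw [dd_cexp hl, dd_cexp hl]; ring

lemma hol_of_db {f : ℂ → ℂ} {z : ℂ} (hf : DifferentiableAt ℝ f z) (h : db f z = 0) :
    DifferentiableAt ℂ f z := by
  rw [differentiableAt_complex_iff_differentiableAt_real]
  refine ⟨hf, ?_⟩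
  unfold db dd at h
  have h2 : fderiv ℝ f z 1 + I * fderiv ℝ f z I = 0 := by simpa using h
  rw [smul_eq_mul]
  linear_combination (-I) * h2 + (fderiv ℝ f z) I * I_mul_I

lemma TF.CT_tendsto {h : ℂ → ℂ} (hh : TF h) : Tendsto (CT h) (cocompact ℂ) (𝓝 0) := by
  obtain ⟨M, hM⟩ := hh.decay1
  have h1 : Tendsto (fun z : ℂ => 1 + ‖z‖) (cocompact ℂ) atTop :=
    tendsto_atTop_add_const_left _ _ (tendsto_norm_cocompact_atTop)
  refine squeeze_zero_norm (fun z => ?_) (h1.const_div_atTop M)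
  rw [le_div_iff₀ (by positivity)]; exact hM z

/-- Solution of the Beltrami equation. -/
lemma beltrami {μ : ℂ → ℂ} (hμ : TF μ) {k : ℝ} (hk : k < 1) (hμk : ∀ z, ‖μ z‖ ≤ k) :
    ∃ v, TF v ∧ (∀ z, v z = μ z * (1 + BT v z)) ∧ ∀ z, 1 + BT v z ≠ 0 := by
  set g := gsol μ with hgdef
  have hg : TF g := gsol_TF hμ hk hμk
  set l := CT g with hl
  have hls : ContDiff ℝ ∞ l := hg.CT_smooth
  have hes : ContDiff ℝ ∞ (fun z => cexp (l z)) := hls.cexp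
  set v : ℂ → ℂ := fun z => μ z * cexp (l z) with hv
  have hvT : TF v := hμ.mulc hes
  have hdzv : dz v = fun z => g z * cexp (l z) := by
    ext z
    rw [hv, dz_mul hμ.smooth hes, dz_cexp hls, hgdef, gsol_eq hμ hk hμk z]
    rw [← hgdef, hl, BT]; ring
  have key : ∀ z, 1 + BT v z = cexp (l z) := by
    set E : ℂ → ℂ := fun z => (BT v z + (-1) * cexp (l z)) with hE
    have hsm : ContDiff ℝ ∞ (fun z => (-1) * cexp (l z)) := contDiff_const.mul hes
    have hEd : Differentiable ℂ E := by
      intro z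
      refine hol_of_db (diffAt (hvT.BT_smooth.add hsm) z) ?_
      rw [hE, db_add hvT.BT_smooth hsm]
      have e1 : db (BT v) z = g z * cexp (l z) := by
        unfold BT; rw [hvT.dz_CT, hvT.dz.db_CT', hdzv]
      have e2 : db (fun z => (-1) * cexp (l z)) z = - (g z * cexp (l z)) := by
        have : db (fun z => (-1) * cexp (l z)) z = - db (fun z => cexp (l z)) z := by
          unfold db
          rw [dd_mul contDiff_const hes, dd_mul contDiff_const hes, dd_const, dd_const]; ring
        rw [this, db_cexp hls, hl, hg.db_CT']; ring
      rw [e1, e2]; ring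
    have hlim : Tendsto E (cocompact ℂ) (𝓝 (0 + (-1) * cexp 0)) := by
      refine Tendsto.add ?_ (Tendsto.const_mul _ ?_)
      · unfold BT; rw [hvT.dz_CT]; exact hvT.dz.CT_tendsto
      · exact (Complex.continuous_exp.tendsto 0).comp hg.CT_tendsto
    intro z
    have := hEd.apply_eq_of_tendsto_cocompact z hlim
    simp only [hE, Complex.exp_zero] at this
    linear_combination this
  refine ⟨v, hvT, fun z => by rw [key], fun z => by rw [key]; exact Complex.exp_ne_zero _⟩

end Inv17


namespace Inv17
open MeasureTheory Complex Set Filter Topology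
open scoped ContDiff Convolution ComplexConjugate

lemma fd_wirt (f : ℂ → ℂ) (z v : ℂ) :
    fderiv ℝ f z v = dz f z * v + db f z * conj v := by
  rw [fd_decomp]
  unfold dz db
  have h1 : v = v.re + v.im * I := (re_add_im v).symm
  have h2 : conj v = v.re - v.im * I := by
    apply Complex.ext <;> simp
  rw [h2]
  linear_combination (-(dd 1 f z - I * dd I f z) / 2) * h1 + (v.im * dd I f z) * I_mul_I

/-- A proper local homeomorphism of the plane which is injective over some point is bijective. -/
lemma bij_of_local {f : ℂ → ℂ} (hf : IsLocalHomeomorph f) {M : ℝ} (hM : ∀ z, ‖f z - z‖ ≤ M)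
    (w0 : ℂ) (hw0 : ∀ x y, f x = w0 → f y = w0 → x = y) : Function.Bijective f := by
  have hcont := hf.continuous
  have hopen := hf.isOpenMap
  constructor
  · -- injectivity
    set K : Set (ℂ × ℂ) := {p | f p.1 = f p.2 ∧ p.1 ≠ p.2} with hK
    have hKc : IsClosed K := by
      rw [← isOpen_compl_iff, isOpen_iff_mem_nhds]
      rintro ⟨x, y⟩ hp
      by_cases hxy : f x = f y
      · have hxy' : x = y := by
          by_contra h; exact hp ⟨hxy, h⟩
        subst hxy'
        obtain ⟨e, hxe, hfe⟩ := hf x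
        have hn : e.source ∈ 𝓝 x := e.open_source.mem_nhds hxe
        filter_upwards [prod_mem_nhds hn hn] with p hp h
        apply h.2
        apply e.injOn hp.1 hp.2
        rw [← hfe]; exact h.1
      · have : {p : ℂ × ℂ | f p.1 ≠ f p.2} ∈ 𝓝 (x, y) :=
          (isOpen_ne_fun (hcont.comp continuous_fst) (hcont.comp continuous_snd)).mem_nhds hxy
        filter_upwards [this] with p hp h using hp h.1
    set A : Set ℂ := (fun p : ℂ × ℂ => f p.1) '' K with hA
    have hAo : IsOpen A := by
      rw [isOpen_iff_mem_nhds]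
      rintro w ⟨⟨x, y⟩, ⟨h1, h2⟩, h3⟩
      simp only at h1 h2 h3
      obtain ⟨U, V, hU, hV, hxU, hyV, hUV⟩ := t2_separation h2
      have n1 : f '' U ∈ 𝓝 w := (hopen U hU).mem_nhds ⟨x, hxU, h3⟩
      have n2 : f '' V ∈ 𝓝 w := (hopen V hV).mem_nhds ⟨y, hyV, by rw [← h1, h3]⟩
      filter_upwards [n1, n2] with w' ⟨a, ha, haw⟩ ⟨b, hb, hbw⟩
      refine ⟨(a, b), ⟨by simp [haw, hbw], ?_⟩, haw⟩
      exact fun h => disjoint_left.1 hUV ha ((show a = b from h) ▸ hb)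
    have hAc : IsClosed A := by
      apply IsSeqClosed.isClosed
      intro w a hw hwa
      choose p hp hpw using hw
      obtain ⟨C, hC⟩ := hwa.norm.bddAbove_range
      have hb : ∀ n, p n ∈ Metric.closedBall (0 : ℂ × ℂ) (C + M) := by
        intro n
        have hCn : ‖w n‖ ≤ C := hC ⟨n, rfl⟩
        have aux : ∀ x, f x = w n → ‖x‖ ≤ C + M := by
          intro x hx
          have := hM x
          have h2 : ‖x‖ ≤ ‖f x‖ + ‖f x - x‖ := by
            have := norm_sub_le (f x) (f x - x); simpa using this
          rw [hx] at h2 this; linarith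
        rw [mem_closedBall_zero_iff, Prod.norm_def]
        exact max_le (aux _ (hpw n)) (aux _ ((hp n).1 ▸ hpw n))
      obtain ⟨q, -, φ, hφ, hlim⟩ := tendsto_subseq_of_bounded Metric.isBounded_closedBall hb
      refine ⟨q, hKc.mem_of_tendsto hlim (Eventually.of_forall fun n => hp _), ?_⟩
      have h1 : Tendsto (fun n => f (p (φ n)).1) atTop (𝓝 (f q.1)) :=
        (hcont.tendsto _).comp ((continuous_fst.tendsto q).comp hlim)
      have h2 : Tendsto (fun n => f (p (φ n)).1) atTop (𝓝 a) := by
        simp only [hpw]; exact hwa.comp hφ.tendsto_atTop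
      exact tendsto_nhds_unique h1 h2
    have hAe : A = ∅ := by
      rcases isClopen_iff.1 ⟨hAc, hAo⟩ with h | h
      · exact h
      · exfalso
        have : w0 ∈ A := h ▸ mem_univ _
        obtain ⟨p, hp, hpw⟩ := this
        exact hp.2 (hw0 _ _ hpw (hp.1 ▸ hpw))
    intro x y hxy
    by_contra h
    have : f x ∈ A := ⟨(x, y), ⟨hxy, h⟩, rfl⟩
    rw [hAe] at this; exact this
  · have hprop : IsProperMap f := by
      rw [isProperMap_iff_tendsto_cocompact]
      refine ⟨hcont, ?_⟩
      rw [← Metric.cobounded_eq_cocompact, ← tendsto_norm_atTop_iff_cobounded]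
      refine tendsto_atTop_mono (f := fun z => ‖z‖ - M) (fun z => ?_)
        (tendsto_atTop_add_const_right _ _ tendsto_norm_cobounded_atTop)
      have := hM z
      have h2 : ‖z‖ ≤ ‖f z‖ + ‖f z - z‖ := by
        have := norm_sub_le (f z) (f z - z); simpa using this
      linarith
    have hcl : IsClopen (range f) := ⟨hprop.isClosedMap.isClosed_range, hopen.isOpen_range⟩
    exact range_eq_univ.1 (hcl.eq_univ (range_nonempty f))

theorem beltrami_diffeo {μ : ℂ → ℂ} (hμ : TF μ) {k : ℝ} (hk : k < 1) (hμk : ∀ z, ‖μ z‖ ≤ k) :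
    ∃ f f' : ℂ → ℂ, ContDiff ℝ ∞ f ∧ ContDiff ℝ ∞ f' ∧ (∀ z, f' (f z) = z) ∧ (∀ z, f (f' z) = z) ∧
      (∃ M, ∀ z, ‖f z - z‖ ≤ M) ∧
      ∀ z, ∃ a : ℂ, a ≠ 0 ∧ ∀ v, fderiv ℝ f z v = a * (v + μ z * conj v) := by
  obtain ⟨v, hv, hv1, hv2⟩ := beltrami hμ hk hμk
  set f : ℂ → ℂ := fun z => z + CT v z with hf
  have hfs : ContDiff ℝ ∞ f := contDiff_id.add hv.CT_smooth
  have hder : ∀ z w, fderiv ℝ f z w = (1 + BT v z) * (w + μ z * conj w) := by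
    intro z w
    have h1 : fderiv ℝ f z w = w + fderiv ℝ (CT v) z w := by
      rw [hf, fderiv_fun_add differentiableAt_fun_id (diffAt hv.CT_smooth z)]; simp
    rw [h1, fd_wirt, hv.db_CT', hv1]
    unfold BT; ring
  have hinj : ∀ z, Function.Injective (fderiv ℝ f z) := by
    intro z
    rw [injective_iff_map_eq_zero]
    intro w hw
    rw [hder] at hw
    have h1 := (mul_eq_zero.1 hw).resolve_left (hv2 z)
    have h2 : ‖w‖ = ‖μ z‖ * ‖w‖ := by
      have : w = -(μ z * conj w) := by linear_combination h1
      conv_lhs => rw [this]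
      simp
    have h3 := hμk z
    by_contra h4
    have h5 : 0 < ‖w‖ := norm_pos_iff.2 h4
    nlinarith
  set A : ℂ → (ℂ ≃L[ℝ] ℂ) := fun z =>
    (LinearEquiv.ofInjectiveEndo (fderiv ℝ f z : ℂ →ₗ[ℝ] ℂ) (hinj z)).toContinuousLinearEquiv with hA
  have hAe : ∀ z, (A z : ℂ →L[ℝ] ℂ) = fderiv ℝ f z := by
    intro z; ext w; rfl
  have hloc : IsLocalHomeomorph f := by
    refine IsLocalHomeomorph.mk _ fun z => ?_
    have hs : HasStrictFDerivAt f (A z : ℂ →L[ℝ] ℂ) z := by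
      rw [hAe]; exact hfs.hasStrictFDerivAt (by simp)
    exact ⟨hs.toOpenPartialHomeomorph f, hs.mem_toOpenPartialHomeomorph_source, fun _ _ => rfl⟩
  obtain ⟨M, hM⟩ := hv.decay1
  have hMf : ∀ z, ‖f z - z‖ ≤ M := by
    intro z
    have : f z - z = CT v z := by simp [hf]
    rw [this]
    refine le_trans ?_ (hM z)
    nlinarith [norm_nonneg (CT v z), norm_nonneg z]
  -- far away, `f` is injective
  obtain ⟨R1, hR1, hRv⟩ := hv.bound
  obtain ⟨M2, hM2⟩ := hv.dz.decay1
  have hfar : ∀ z, max R1 (2 * M2) ≤ ‖z‖ → ‖fderiv ℝ (CT v) z‖ ≤ 1 / 2 := by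
    intro z hz
    refine ContinuousLinearMap.opNorm_le_bound _ (by norm_num) fun w => ?_
    rw [fd_wirt, hv.db_CT', hRv z ((le_max_left _ _).trans hz), hv.dz_CT]
    simp only [zero_mul, add_zero, norm_mul]
    gcongr
    have h1 := hM2 z
    have h2 := (le_max_right _ _).trans hz
    have h3 := norm_nonneg (CT (dz v) z)
    have h4 := norm_nonneg z
    by_contra hc
    push Not at hc
    nlinarith
  have hM0 : 0 ≤ M := (norm_nonneg _).trans (hMf 0)
  have hbij : Function.Bijective f := by
    set T : ℝ := max R1 (2 * M2) + M with hT
    have hT0 : 0 ≤ T := by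
      have := le_max_left R1 (2 * M2); linarith
    refine bij_of_local hloc hMf (T : ℂ) fun x y hx hy => ?_
    have hmem : ∀ x, f x = T → x ∈ Metric.closedBall (T : ℂ) M := by
      intro x hx
      rw [mem_closedBall_iff_norm, ← hx, norm_sub_rev]; exact hMf x
    have hbig : ∀ x ∈ Metric.closedBall (T : ℂ) M, max R1 (2 * M2) ≤ ‖x‖ := by
      intro x hx
      rw [mem_closedBall_iff_norm] at hx
      have h1 : ‖(T : ℂ)‖ ≤ ‖x‖ + ‖x - T‖ := by
        have := norm_sub_le x (x - T); simpa using this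
      rw [Complex.norm_real, Real.norm_eq_abs, abs_of_nonneg hT0] at h1
      linarith
    have := (convex_closedBall (T : ℂ) M).norm_image_sub_le_of_norm_fderiv_le (𝕜 := ℝ) (f := CT v)
      (C := 1 / 2) (fun x _ => diffAt hv.CT_smooth x) (fun x hx => hfar x (hbig x hx))
      (hmem x hx) (hmem y hy)
    have e : CT v y - CT v x = -(y - x) := by
      have e1 : x + CT v x = T := hx
      have e2 : y + CT v y = T := hy
      linear_combination e2 - e1
    rw [e, norm_neg] at this
    have h0 : ‖y - x‖ = 0 := by
      have := norm_nonneg (y - x); linarith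
    exact (sub_eq_zero.1 (norm_eq_zero.1 h0)).symm
  set e : ℂ ≃ₜ ℂ := (Equiv.ofBijective f hbij).toHomeomorphOfContinuousOpen hloc.continuous
    hloc.isOpenMap with he
  have hsymm : ContDiff ℝ ∞ e.symm := by
    refine e.contDiff_symm (f₀' := A) (fun z => ?_) hfs
    rw [hAe]; exact (diffAt hfs z).hasFDerivAt
  refine ⟨f, e.symm, hfs, hsymm, fun z => e.symm_apply_apply z, fun z => e.apply_symm_apply z,
    ⟨M, hMf⟩, fun z => ⟨1 + BT v z, hv2 z, hder z⟩⟩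

end Inv17


namespace Inv17
open MeasureTheory Complex Set Filter Topology
open scoped ContDiff Convolution ComplexConjugate

theorem isothermal {E F G : ℂ → ℝ} (hE : ContDiff ℝ ∞ E) (hF : ContDiff ℝ ∞ F)
    (hG : ContDiff ℝ ∞ G) (hE0 : ∀ z, 0 < E z) (hD0 : ∀ z, 0 < E z * G z - F z ^ 2)
    {R : ℝ} (hR : ∀ z, R ≤ ‖z‖ → E z = G z ∧ F z = 0) :
    ∃ f f' : ℂ → ℂ, ContDiff ℝ ∞ f ∧ ContDiff ℝ ∞ f' ∧ (∀ z, f' (f z) = z) ∧ (∀ z, f (f' z) = z) ∧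
      (∃ M, ∀ z, ‖f z - z‖ ≤ M) ∧
      ∀ z, ∃ ρ : ℝ, 0 < ρ ∧ ∀ v, ‖fderiv ℝ f z v‖ ^ 2 =
        ρ * (E z * v.re ^ 2 + 2 * F z * v.re * v.im + G z * v.im ^ 2) := by
  set D : ℂ → ℝ := fun z => E z * G z - F z ^ 2 with hD
  have hG0 : ∀ z, 0 < G z := by
    intro z
    have h1 := hD0 z
    have h2 := hE0 z
    by_contra h
    push Not at h
    nlinarith [sq_nonneg (F z)]
  have hDs : ContDiff ℝ ∞ (fun z => √(D z)) :=
    ((hE.mul hG).sub (hF.pow 2)).sqrt fun z => (hD0 z).ne'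
  set S : ℂ → ℝ := fun z => E z + G z + 2 * √(D z) with hS
  have hSs : ContDiff ℝ ∞ S := (hE.add hG).add (contDiff_const.mul hDs)
  have hq0 : ∀ z, 0 < √(D z) := fun z => Real.sqrt_pos.2 (hD0 z)
  have hqq : ∀ z, √(D z) ^ 2 = E z * G z - F z ^ 2 := fun z => Real.sq_sqrt (hD0 z).le
  have hS0 : ∀ z, 0 < S z := fun z => by
    have := hE0 z; have := hG0 z; have := hq0 z
    simp only [hS]; positivity
  set a : ℂ → ℝ := fun z => (E z - G z) / S z with ha
  set b : ℂ → ℝ := fun z => 2 * F z / S z with hb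
  have has : ContDiff ℝ ∞ a := (hE.sub hG).div hSs fun z => (hS0 z).ne'
  have hbs : ContDiff ℝ ∞ b := (contDiff_const.mul hF).div hSs fun z => (hS0 z).ne'
  set μ : ℂ → ℂ := fun z => (a z : ℂ) + (b z : ℂ) * I with hμ
  have hμs : ContDiff ℝ ∞ μ :=
    (ofRealCLM.contDiff.comp has).add ((ofRealCLM.contDiff.comp hbs).mul contDiff_const)
  have hre : ∀ z, (μ z).re = a z := fun z => by simp [hμ]
  have him : ∀ z, (μ z).im = b z := fun z => by simp [hμ]
  have hab : ∀ z, a z ^ 2 + b z ^ 2 = (E z + G z - 2 * √(D z)) / S z := by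
    intro z
    have h1 := (hS0 z).ne'
    simp only [ha, hb]
    field_simp
    simp only [hS]
    linear_combination 4 * hqq z
  have hμT : TF μ := by
    refine ⟨hμs, HasCompactSupport.of_support_subset_isCompact
      (isCompact_closedBall (0:ℂ) R) fun z hz => ?_⟩
    by_contra h
    rw [mem_closedBall_zero_iff, not_le] at h
    obtain ⟨h1, h2⟩ := hR z h.le
    apply hz
    simp [hμ, ha, hb, h1, h2]
  have hn : ∀ z, ‖μ z‖ ^ 2 = a z ^ 2 + b z ^ 2 := by
    intro z
    rw [← Complex.normSq_eq_norm_sq, Complex.normSq_apply, hre, him]; ring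
  have hlt : ∀ z, ‖μ z‖ < 1 := by
    intro z
    have : ‖μ z‖ ^ 2 < 1 := by
      rw [hn, hab, div_lt_one (hS0 z)]
      simp only [hS]; linarith [hq0 z]
    nlinarith [norm_nonneg (μ z)]
  obtain ⟨z0, hz0⟩ := hμT.cont.norm.exists_forall_ge_of_hasCompactSupport hμT.supp.norm
  obtain ⟨f, f', h1, h2, h3, h4, h5, h6⟩ := beltrami_diffeo hμT (hlt z0) hz0
  refine ⟨f, f', h1, h2, h3, h4, h5, fun z => ?_⟩
  obtain ⟨c, hc0, hc⟩ := h6 z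
  have hcp : 0 < ‖c‖ := norm_pos_iff.2 hc0
  refine ⟨‖c‖ ^ 2 * (4 / S z), by have := hS0 z; positivity, fun v => ?_⟩
  rw [hc, norm_mul, mul_pow, mul_assoc]
  congr 1
  rw [← Complex.normSq_eq_norm_sq, Complex.normSq_apply]
  simp only [add_re, mul_re, add_im, mul_im, hre, him, conj_re, conj_im]
  have e1 := hab z
  have e2 : a z * S z = E z - G z := by simp only [ha]; field_simp [(hS0 z).ne']
  have e3 : b z * S z = 2 * F z := by simp only [hb]; field_simp [(hS0 z).ne']
  rw [eq_div_iff (hS0 z).ne'] at e1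
  rw [show ∀ t : ℝ, 4 / S z * t = 4 * t / S z from fun t => by ring, eq_div_iff (hS0 z).ne']
  have e4 : S z = E z + G z + 2 * √(D z) := rfl
  linear_combination (v.re ^ 2 + v.im ^ 2) * e1 + 2 * (v.re ^ 2 - v.im ^ 2) * e2 +
    4 * v.re * v.im * e3 + (v.re ^ 2 + v.im ^ 2) * e4

end Inv17


namespace Inv17
open MeasureTheory Complex Set Filter Topology
open scoped ContDiff Convolution ComplexConjugate

/-- Real-conformal implies complex linear or antilinear. -/
lemma conf_alt {a b : ℂ} {ρ : ℝ} (h : ∀ u : ℂ, ‖a * u + b * conj u‖ ^ 2 = ρ * ‖u‖ ^ 2) :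
    a = 0 ∨ b = 0 := by
  have h1 := h 1
  have h2 := h I
  have h3 := h (1 + I)
  simp only [← Complex.normSq_eq_norm_sq, Complex.normSq_apply] at h1 h2 h3
  simp at h1 h2 h3
  have e1 : a.re * b.re + a.im * b.im = 0 := by linarith
  have e2 : a.im * b.re - a.re * b.im = 0 := by linarith
  have : (a.re ^ 2 + a.im ^ 2) * (b.re ^ 2 + b.im ^ 2) = 0 := by
    linear_combination (a.re * b.re + a.im * b.im) * e1 + (a.im * b.re - a.re * b.im) * e2
  rcases mul_eq_zero.1 this with h | h
  · left; apply Complex.ext <;> simp <;> nlinarith [sq_nonneg a.re, sq_nonneg a.im]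
  · right; apply Complex.ext <;> simp <;> nlinarith [sq_nonneg b.re, sq_nonneg b.im]

/-- The Liouville argument. -/
lemma liouville_const {q : ℂ} {Ψ K : ℂ → ℂ} (hK : DifferentiableOn ℂ K {q}ᶜ)
    (hn : ∀ w, w ≠ q → ‖K w‖ = ‖Ψ w - q‖) (hq : ∀ w, w ≠ q → Ψ w ≠ q)
    (hinv : ∀ w, w ≠ q → Ψ (Ψ w) = w)
    (hlim : Tendsto Ψ (cocompact ℂ) (𝓝 q)) {B : ℝ}
    (hB : ∀ᶠ w in 𝓝[≠] q, ‖w - q‖ * ‖Ψ w - q‖ ≤ B) :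
    ∃ c, ∀ w, w ≠ q → (w - q) * K w = c := by
  set W : ℂ → ℂ := fun w => (w - q) * K w with hW
  have hWd : DifferentiableOn ℂ W {q}ᶜ := (differentiableOn_id.sub_const q).mul hK
  have hWn : ∀ w, w ≠ q → ‖W w‖ = ‖w - q‖ * ‖Ψ w - q‖ := by
    intro w hw; simp only [hW, norm_mul, hn w hw]
  rw [eventually_nhdsWithin_iff, Metric.eventually_nhds_iff] at hB
  obtain ⟨δ, hδ, hB⟩ := hB
  have hBW : ∀ w, w ≠ q → dist w q < δ → ‖W w‖ ≤ B := by
    intro w hw hd; rw [hWn w hw]; exact hB hd hw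
  have hbd : IsBoundedUnder (· ≤ ·) (𝓝[≠] q) (norm ∘ fun w => W w - W q) := by
    refine ⟨B + ‖W q‖, ?_⟩
    rw [eventually_map, eventually_nhdsWithin_iff, Metric.eventually_nhds_iff]
    refine ⟨δ, hδ, fun w hd hw => ?_⟩
    exact (norm_sub_le _ _).trans (by gcongr; exact hBW w hw hd)
  have hrem := Complex.differentiableOn_update_limUnder_of_isLittleO (f := W) (c := q)
    (s := univ) univ_mem (by rw [← compl_eq_univ_sdiff]; exact hWd) hbd.isLittleO_sub_self_inv
  set c := limUnder (𝓝[≠] q) W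
  set V := Function.update W q c with hV
  have hVW : ∀ w, w ≠ q → V w = W w := fun w hw => Function.update_of_ne hw _ _
  have hVd : Differentiable ℂ V := differentiableOn_univ.1 hrem
  have hfar : ∀ᶠ w in cocompact ℂ, ‖V w‖ ≤ B := by
    have h1 : ∀ᶠ w in cocompact ℂ, dist (Ψ w) q < δ := hlim.eventually (Metric.ball_mem_nhds q hδ)
    have h2 : ∀ᶠ w in cocompact ℂ, w ≠ q := (isCompact_singleton (x := q)).compl_mem_cocompact
    filter_upwards [h1, h2] with w hw1 hw2
    rw [hVW w hw2, hWn w hw2]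
    have := hBW (Ψ w) (hq w hw2) hw1
    rw [hWn _ (hq w hw2), hinv w hw2, mul_comm] at this
    exact this
  have hb : Bornology.IsBounded (range V) := by
    rw [Filter.eventually_iff, mem_cocompact] at hfar
    obtain ⟨T, hT, hTs⟩ := hfar
    refine ((hT.image hVd.continuous).isBounded.union
      (Metric.isBounded_closedBall (x := (0:ℂ)) (r := B))).subset ?_
    rintro _ ⟨w, rfl⟩
    by_cases hw : w ∈ T
    · exact Or.inl ⟨w, hw, rfl⟩
    · right; rw [mem_closedBall_zero_iff]; exact hTs hw
  refine ⟨V q, fun w hw => ?_⟩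
  rw [← hVd.apply_eq_apply_of_bounded hb w q, hVW w hw]

theorem planar {q : ℂ} {Φ : ℂ → ℂ} (hΦ : ∀ z, z ≠ q → ContDiffAt ℝ ∞ Φ z)
    (hΦq : ∀ z, z ≠ q → Φ z ≠ q) (hΦinv : ∀ z, z ≠ q → Φ (Φ z) = z)
    (hΦfree : ∀ z, z ≠ q → Φ z ≠ z) (hΦlim : Tendsto Φ (cocompact ℂ) (𝓝 q))
    {C : ℝ} (hC : ∀ᶠ z in 𝓝[≠] q, ‖Φ z‖ * ‖z - q‖ ≤ C)
    {f f' : ℂ → ℂ} (hf : ContDiff ℝ ∞ f) (hf' : ContDiff ℝ ∞ f') (h1 : ∀ z, f' (f z) = z)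
    (h2 : ∀ z, f (f' z) = z) {M : ℝ} (hM : ∀ z, ‖f z - z‖ ≤ M)
    (hconf : ∀ z, z ≠ q → ∃ ρ : ℝ, 0 < ρ ∧ ∀ v,
      ‖fderiv ℝ f (Φ z) (fderiv ℝ Φ z v)‖ ^ 2 = ρ * ‖fderiv ℝ f z v‖ ^ 2) :
    ∃ h h' : ℂ → ℂ, ContDiff ℝ ∞ h ∧ ContDiff ℝ ∞ h' ∧ (∀ z, h' (h z) = z) ∧ (∀ z, h (h' z) = z) ∧
      h q = 0 ∧ ∀ z, z ≠ q → h (Φ z) = -(conj (h z))⁻¹ := by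
  set p := f q with hp
  have hfinj : Function.Injective f := Function.LeftInverse.injective h1
  have hf'p : ∀ w, w ≠ p → f' w ≠ q := fun w hw h => hw (by rw [hp, ← h, h2])
  set Ψ : ℂ → ℂ := fun w => f (Φ (f' w)) with hΨ
  have hΨs : ContDiffOn ℝ ∞ Ψ {p}ᶜ := by
    intro w hw
    refine ContDiffAt.contDiffWithinAt ?_
    exact hf.contDiffAt.comp w ((hΦ _ (hf'p w hw)).comp w hf'.contDiffAt)
  have hΨp : ∀ w, w ≠ p → Ψ w ≠ p := fun w hw h => hΦq _ (hf'p w hw) (hfinj h)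
  have hΨinv : ∀ w, w ≠ p → Ψ (Ψ w) = w := by
    intro w hw; simp only [hΨ, h1]; rw [hΦinv _ (hf'p w hw), h2]
  have hΨfree : ∀ w, w ≠ p → Ψ w ≠ w := by
    intro w hw h
    apply hΦfree _ (hf'p w hw)
    apply hfinj; rw [h2]; exact h
  have hopen : IsOpen ({p}ᶜ : Set ℂ) := isOpen_compl_singleton
  have hΨd : ∀ w, w ≠ p → DifferentiableAt ℝ Ψ w := fun w hw =>
    (hΨs.contDiffAt (hopen.mem_nhds hw)).differentiableAt (by simp)
  -- conformality of `Ψ`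
  have hΨc : ∀ w, w ≠ p → ∃ ρ : ℝ, 0 < ρ ∧ ∀ u, ‖fderiv ℝ Ψ w u‖ ^ 2 = ρ * ‖u‖ ^ 2 := by
    intro w hw
    obtain ⟨ρ, hρ, hρc⟩ := hconf _ (hf'p w hw)
    refine ⟨ρ, hρ, fun u => ?_⟩
    have d1 : HasFDerivAt f' (fderiv ℝ f' w) w := (diffAt hf' w).hasFDerivAt
    have d2 : HasFDerivAt Φ (fderiv ℝ Φ (f' w)) (f' w) :=
      ((hΦ _ (hf'p w hw)).differentiableAt (by simp)).hasFDerivAt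
    have d3 : HasFDerivAt f (fderiv ℝ f (Φ (f' w))) (Φ (f' w)) := (diffAt hf _).hasFDerivAt
    have d4 : HasFDerivAt f (fderiv ℝ f (f' w)) (f' w) := (diffAt hf _).hasFDerivAt
    have e1 : fderiv ℝ Ψ w u = fderiv ℝ f (Φ (f' w)) (fderiv ℝ Φ (f' w) (fderiv ℝ f' w u)) := by
      have := (d3.comp w (d2.comp w d1)).fderiv
      exact congrArg (fun L => L u) this
    have e2 : fderiv ℝ f (f' w) (fderiv ℝ f' w u) = u := by
      have h5 := (d4.comp w d1).fderiv
      have h6 : f ∘ f' = id := funext h2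
      rw [h6, fderiv_id] at h5
      exact (congrArg (fun L => L u) h5).symm
    rw [e1, hρc, e2]
  have halt : ∀ w, w ≠ p → (dz Ψ w = 0 ∨ db Ψ w = 0) ∧ (dz Ψ w ≠ 0 ∨ db Ψ w ≠ 0) := by
    intro w hw
    obtain ⟨ρ, hρ, hρc⟩ := hΨc w hw
    refine ⟨conf_alt (ρ := ρ) fun u => by rw [← fd_wirt, hρc], ?_⟩
    by_contra hcon
    push Not at hcon
    have := hρc 1
    rw [fd_wirt, hcon.1, hcon.2] at this
    simp at this
    linarith
  have hfdc : ContinuousOn (fderiv ℝ Ψ) {p}ᶜ := hΨs.continuousOn_fderiv_of_isOpen hopen (by simp)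
  have hddc : ∀ v, ContinuousOn (dd v Ψ) {p}ᶜ := fun v => hfdc.clm_apply continuousOn_const
  have hdzc : ContinuousOn (dz Ψ) {p}ᶜ :=
    ((hddc 1).sub (continuousOn_const.mul (hddc I))).div_const _
  have hdbc : ContinuousOn (db Ψ) {p}ᶜ :=
    ((hddc 1).add (continuousOn_const.mul (hddc I))).div_const _
  have ho1 := hdzc.isOpen_inter_preimage hopen (isOpen_compl_singleton (x := (0:ℂ)))
  have ho2 := hdbc.isOpen_inter_preimage hopen (isOpen_compl_singleton (x := (0:ℂ)))
  have hconn : IsPreconnected ({p}ᶜ : Set ℂ) :=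
    (isConnected_compl_singleton_of_one_lt_rank (by simp) p).isPreconnected
  have hcases := hconn.subset_or_subset ho1 ho2 (by
      rw [disjoint_left]
      rintro w ⟨hw, hw1⟩ ⟨-, hw2⟩
      rcases (halt w hw).1 with h | h
      exacts [hw1 h, hw2 h]) (by
      intro w hw
      rcases (halt w hw).2 with h | h
      exacts [Or.inl ⟨hw, h⟩, Or.inr ⟨hw, h⟩])
  -- behaviour at infinity and at `p`
  have hlim : Tendsto Ψ (cocompact ℂ) (𝓝 p) := by
    have t1 : Tendsto f' (cocompact ℂ) (cocompact ℂ) := by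
      have hh : IsClosedEmbedding f' := by
        have e : ℂ ≃ₜ ℂ := ⟨⟨f', f, h2, h1⟩, hf'.continuous, hf.continuous⟩
        exact (⟨⟨f', f, h2, h1⟩, hf'.continuous, hf.continuous⟩ : ℂ ≃ₜ ℂ).isClosedEmbedding
      exact hh.tendsto_cocompact
    exact (hf.continuous.tendsto q).comp (hΦlim.comp t1)
  have hBd : ∃ B, ∀ᶠ w in 𝓝[≠] p, ‖w - p‖ * ‖Ψ w - p‖ ≤ B := by
    obtain ⟨L, hL⟩ := (diffAt hf q).isBigO_sub.bound
    have t1 : Tendsto f' (𝓝[≠] p) (𝓝[≠] q) := by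
      refine tendsto_nhdsWithin_of_tendsto_nhds_of_eventually_within _ ?_ ?_
      · have := hf'.continuous.tendsto p
        rw [hp, h1] at this
        exact this.mono_left nhdsWithin_le_nhds
      · exact eventually_nhdsWithin_of_forall fun w hw => hf'p w hw
    have hb : ∀ᶠ z in 𝓝 q, ‖z - q‖ < 1 := by
      have := Metric.ball_mem_nhds q one_pos
      filter_upwards [this] with z hz; rwa [mem_ball_iff_norm] at hz
    refine ⟨|L| * (C + (M + ‖p‖)), ?_⟩
    have hM0 : 0 ≤ M := (norm_nonneg _).trans (hM 0)
    filter_upwards [t1.eventually hC, t1.eventually (nhdsWithin_le_nhds hL),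
      t1.eventually (nhdsWithin_le_nhds hb)] with w hw1 hw2 hw3
    rw [h2, ← hp] at hw2
    have hw4 : ‖Ψ w - p‖ ≤ ‖Φ (f' w)‖ + (M + ‖p‖) := by
      have : Ψ w - p = Φ (f' w) + ((f (Φ (f' w)) - Φ (f' w)) - p) := by simp only [hΨ]; ring
      rw [this]
      refine (norm_add_le _ _).trans ?_
      gcongr
      refine (norm_sub_le _ _).trans ?_
      gcongr
      exact hM _
    have hw5 : ‖w - p‖ ≤ |L| * ‖f' w - q‖ := hw2.trans (by gcongr; exact le_abs_self L)
    calc ‖w - p‖ * ‖Ψ w - p‖ ≤ (|L| * ‖f' w - q‖) * (‖Φ (f' w)‖ + (M + ‖p‖)) := by gcongr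
      _ = |L| * (‖Φ (f' w)‖ * ‖f' w - q‖ + ‖f' w - q‖ * (M + ‖p‖)) := by ring
      _ ≤ |L| * (C + 1 * (M + ‖p‖)) := by gcongr
      _ = _ := by ring
  obtain ⟨B, hB⟩ := hBd
  rcases hcases with hcase | hcase
  · -- holomorphic case: contradiction
    exfalso
    have hK : DifferentiableOn ℂ (fun w => Ψ w - p) {p}ᶜ := by
      intro w hw
      refine (DifferentiableAt.sub_const (hol_of_db (hΨd w hw) ?_) p).differentiableWithinAt
      exact ((halt w hw).1).resolve_left (hcase hw).2
    obtain ⟨c, hc⟩ := liouville_const hK (fun w _ => rfl) hΨp hΨinv hlim hB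
    obtain ⟨s, hs⟩ := IsAlgClosed.exists_pow_nat_eq c (n := 2) (by norm_num)
    have hc0 : c ≠ 0 := by
      have hp1 : p + 1 ≠ p := by simp
      rw [← hc (p + 1) hp1]
      exact mul_ne_zero (sub_ne_zero.2 hp1) (sub_ne_zero.2 (hΨp _ hp1))
    have hs0 : s ≠ 0 := by rintro rfl; apply hc0; rw [← hs]; simp
    have hps : p + s ≠ p := by simpa using hs0
    have := hc (p + s) hps
    rw [← hs] at this
    apply hΨfree (p + s) hps
    have h9 : s * (Ψ (p + s) - p - s) = 0 := by linear_combination this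
    have := (mul_eq_zero.1 h9).resolve_left hs0
    linear_combination this
  · have hK : DifferentiableOn ℂ (fun w => conj (Ψ w - p)) {p}ᶜ := by
      intro w hw
      have hz : dz Ψ w = 0 := ((halt w hw).1).resolve_right (hcase hw).2
      have hd : HasFDerivAt (fun w => conj (Ψ w - p))
          (conjCLE.toContinuousLinearMap.comp (fderiv ℝ Ψ w)) w :=
        conjCLE.toContinuousLinearMap.hasFDerivAt.comp w ((hΨd w hw).hasFDerivAt.sub_const p)
      refine (hol_of_db hd.differentiableAt ?_).differentiableWithinAt
      unfold db dd
      rw [hd.fderiv]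
      simp [fd_wirt, hz]
      linear_combination (conj (db Ψ w)) * I_mul_I
    obtain ⟨c, hc⟩ := liouville_const hK (fun w _ => Complex.norm_conj _) hΨp hΨinv hlim hB
    have hp1 : p + 1 ≠ p := by simp
    have hc0 : c ≠ 0 := by
      rw [← hc (p + 1) hp1]
      refine mul_ne_zero (sub_ne_zero.2 hp1) ?_
      rw [map_ne_zero]; exact sub_ne_zero.2 (hΨp _ hp1)
    have hcr : conj c = c := by
      have a1 := hc (p + 1) hp1
      have a2 := hc _ (hΨp (p + 1) hp1)
      rw [hΨinv _ hp1] at a2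
      rw [← a2, map_mul, conj_conj]
      conv_rhs => rw [a2, ← a1]
      ring
    obtain ⟨t, ht⟩ := Complex.conj_eq_iff_real.1 hcr
    have ht0 : t ≠ 0 := by rintro rfl; exact hc0 (by simpa using ht)
    have htneg : t < 0 := by
      by_contra hcon
      have htp : 0 < t := lt_of_le_of_ne (not_lt.1 hcon) ht0.symm
      have hs0 : (√t : ℂ) ≠ 0 := by
        rw [Complex.ofReal_ne_zero]; exact (Real.sqrt_pos.2 htp).ne'
      have hss : (√t : ℂ) * √t = t := by
        rw [← Complex.ofReal_mul, Real.mul_self_sqrt htp.le]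
      have hps : p + √t ≠ p := by simpa using hs0
      have h8 := hc _ hps
      rw [ht, ← hss] at h8
      have h9 : (√t : ℂ) * (conj (Ψ (p + √t) - p) - √t) = 0 := by linear_combination h8
      have h10 := (mul_eq_zero.1 h9).resolve_left hs0
      have h11 := congrArg conj (sub_eq_zero.1 h10)
      rw [conj_conj, conj_ofReal] at h11
      exact hΨfree _ hps (by linear_combination h11)
    set s : ℝ := √(-t) with hs
    have hsp : 0 < s := Real.sqrt_pos.2 (by linarith)
    have hs0 : (s : ℂ) ≠ 0 := by rw [Complex.ofReal_ne_zero]; exact hsp.ne'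
    have hss : (s : ℂ) * s = -t := by
      rw [← Complex.ofReal_mul, hs, Real.mul_self_sqrt (by linarith)]; simp
    refine ⟨fun z => (f z - p) / s, fun y => f' (p + s * y), (hf.sub contDiff_const).div_const _,
      hf'.comp (contDiff_const.add (contDiff_const.mul contDiff_id)), fun z => ?_, fun z => ?_, ?_,
      fun z hz => ?_⟩
    · simp only
      rw [mul_div_cancel₀ _ hs0, add_sub_cancel, h1]
    · simp only
      rw [h2]; field_simp; ring
    · simp [hp]
    · have hfz : f z ≠ p := fun h => hz (hfinj h)
      have h8 := hc _ hfz
      have e : Ψ (f z) = f (Φ z) := by simp only [hΨ, h1]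
      rw [e] at h8
      have h9 := congrArg conj h8
      rw [map_mul, conj_conj, hcr, ht] at h9
      have hne : conj (f z - p) ≠ 0 := by rw [map_ne_zero]; exact sub_ne_zero.2 hfz
      simp only [map_div₀, conj_ofReal]
      field_simp
      linear_combination h9 + hss

end Inv17

namespace Inv17
open MeasureTheory Complex Set Filter Topology
open scoped ContDiff Convolution ComplexConjugate

/-- Ambient space. -/
abbrev VV := EuclideanSpace ℝ (Fin 3)

lemma vv_norm_sq (X : VV) : ‖X‖ ^ 2 = X 0 ^ 2 + X 1 ^ 2 + X 2 ^ 2 := by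
  rw [EuclideanSpace.norm_sq_eq, Fin.sum_univ_three]; simp

noncomputable def nn (z : ℂ) : ℝ := z.re ^ 2 + z.im ^ 2

lemma nn_nonneg (z : ℂ) : 0 ≤ nn z := by unfold nn; positivity

lemma nn_eq (z : ℂ) : nn z = ‖z‖ ^ 2 := by
  rw [Complex.sq_norm, Complex.normSq_apply]; unfold nn; ring

lemma nn_pos (z : ℂ) : 0 < 1 + nn z := by have := nn_nonneg z; linarith

/-- Inverse stereographic projection. -/
noncomputable def iota (z : ℂ) : VV :=
  !₂[2 * z.re / (1 + nn z), 2 * z.im / (1 + nn z), (nn z - 1) / (1 + nn z)]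

/-- North pole. -/
noncomputable def NP : VV := !₂[0, 0, 1]

/-- Stereographic projection. -/
noncomputable def sig (X : VV) : ℂ :=
  ((X 0 / (1 - X 2) : ℝ) : ℂ) + ((X 1 / (1 - X 2) : ℝ) : ℂ) * I

@[simp] lemma iota_0 (z : ℂ) : iota z 0 = 2 * z.re / (1 + nn z) := rfl
@[simp] lemma iota_1 (z : ℂ) : iota z 1 = 2 * z.im / (1 + nn z) := rfl
@[simp] lemma iota_2 (z : ℂ) : iota z 2 = (nn z - 1) / (1 + nn z) := rfl
@[simp] lemma NP_0 : NP 0 = 0 := rfl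
@[simp] lemma NP_1 : NP 1 = 0 := rfl
@[simp] lemma NP_2 : NP 2 = 1 := rfl

lemma vv_ext {X Y : VV} (h0 : X 0 = Y 0) (h1 : X 1 = Y 1) (h2 : X 2 = Y 2) : X = Y := by
  ext i; fin_cases i <;> assumption

lemma sig_re (X : VV) : (sig X).re = X 0 / (1 - X 2) := by
  simp only [sig, add_re, ofReal_re, mul_re, I_re, ofReal_im, I_im]; ring
lemma sig_im (X : VV) : (sig X).im = X 1 / (1 - X 2) := by
  simp only [sig, add_im, ofReal_re, mul_im, I_re, ofReal_im, I_im]; ring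

lemma NP_norm : ‖NP‖ = 1 := by
  have := vv_norm_sq NP
  have h2 : ‖NP‖ ^ 2 = 1 ^ 2 := by rw [this]; simp
  exact (sq_eq_sq₀ (norm_nonneg _) zero_le_one).1 h2

lemma iota_norm (z : ℂ) : ‖iota z‖ = 1 := by
  have h := vv_norm_sq (iota z)
  have hp := (nn_pos z).ne'
  have : ‖iota z‖ ^ 2 = 1 ^ 2 := by
    rw [h]; simp; field_simp; unfold nn; ring
  exact (sq_eq_sq₀ (norm_nonneg _) zero_le_one).1 this

lemma one_sub_iota (z : ℂ) : 1 - iota z 2 = 2 / (1 + nn z) := by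
  have hp := (nn_pos z).ne'
  simp; field_simp; ring

lemma sig_iota (z : ℂ) : sig (iota z) = z := by
  have hp := (nn_pos z).ne'
  apply Complex.ext
  · rw [sig_re, one_sub_iota]; simp; field_simp
  · rw [sig_im, one_sub_iota]; simp; field_simp

lemma iota_ne (z : ℂ) : iota z ≠ NP := by
  intro h
  have h1 := one_sub_iota z
  rw [h] at h1
  have := div_pos two_pos (nn_pos z)
  rw [← h1] at this
  simp at this

lemma two_ne {X : VV} (h : ‖X‖ = 1) (hX : X ≠ NP) : X 2 ≠ 1 := by
  intro h2
  have h3 := vv_norm_sq X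
  rw [h, h2] at h3
  have h0 : X 0 = 0 := by nlinarith [sq_nonneg (X 0), sq_nonneg (X 1)]
  have h1 : X 1 = 0 := by nlinarith [sq_nonneg (X 0), sq_nonneg (X 1)]
  exact hX (vv_ext (by simp [h0]) (by simp [h1]) (by simp [h2]))

lemma iota_sig {X : VV} (h : ‖X‖ = 1) (hX : X ≠ NP) : iota (sig X) = X := by
  have h2 : 1 - X 2 ≠ 0 := sub_ne_zero.2 (two_ne h hX).symm
  have h3 := vv_norm_sq X
  rw [h] at h3
  have hn : nn (sig X) = (1 + X 2) / (1 - X 2) := by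
    unfold nn; rw [sig_re, sig_im]; field_simp; linear_combination -h3
  have hn1 : 1 + nn (sig X) = 2 / (1 - X 2) := by rw [hn]; field_simp; ring
  apply vv_ext
  · rw [iota_0, hn1, sig_re]; field_simp
  · rw [iota_1, hn1, sig_im]; field_simp
  · rw [iota_2, hn1, hn]; field_simp; ring

lemma iota_zero : -iota 0 = NP := by
  apply vv_ext <;> simp [nn]

lemma iota_neg {z : ℂ} (hz : z ≠ 0) : -iota z = iota (-(conj z)⁻¹) := by
  have hn : normSq z ≠ 0 := by simpa using hz
  have e : normSq z = nn z := by rw [normSq_apply]; unfold nn; ring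
  rw [e] at hn
  have hre : (-(conj z)⁻¹).re = - (z.re / nn z) := by
    rw [neg_re, inv_re, normSq_conj, e]; simp
  have him : (-(conj z)⁻¹).im = - (z.im / nn z) := by
    rw [neg_im, inv_im, normSq_conj, e]; simp
  have hnn : nn (-(conj z)⁻¹) = 1 / nn z := by
    have : nn (-(conj z)⁻¹) = nn z / nn z ^ 2 := by
      conv_lhs => unfold nn
      rw [hre, him]
      have : nn z = z.re ^ 2 + z.im ^ 2 := rfl
      field_simp
      rw [this]
    rw [this]; field_simp
  have hp := (nn_pos z).ne'
  have hp' : nn z + 1 ≠ 0 := by rwa [add_comm]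
  apply vv_ext
  · rw [iota_0, hnn, hre]; simp; field_simp; ring
  · rw [iota_1, hnn, him]; simp; field_simp; ring
  · rw [iota_2, hnn]; simp; field_simp; ring

lemma iota_dist (z w : ℂ) :
    ‖iota z - iota w‖ ^ 2 = 4 * ‖z - w‖ ^ 2 / ((1 + nn z) * (1 + nn w)) := by
  have hz := (nn_pos z).ne'
  have hw := (nn_pos w).ne'
  rw [vv_norm_sq, ← nn_eq (z - w)]
  simp only [PiLp.sub_apply, iota_0, iota_1, iota_2]
  field_simp
  unfold nn
  simp only [sub_re, sub_im]
  ring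

lemma iota_dist_NP (z : ℂ) : ‖iota z - NP‖ ^ 2 = 4 / (1 + nn z) := by
  have hz := (nn_pos z).ne'
  rw [vv_norm_sq]
  simp only [PiLp.sub_apply, iota_0, iota_1, iota_2, NP_0, NP_1, NP_2]
  field_simp
  unfold nn
  ring

lemma nn_contDiff : ContDiff ℝ ∞ nn := by
  unfold nn
  exact (reCLM.contDiff.pow 2).add (imCLM.contDiff.pow 2)

lemma iota_contDiff : ContDiff ℝ ∞ iota := by
  rw [contDiff_euclidean]
  have h1 : ContDiff ℝ ∞ fun z => 1 + nn z := contDiff_const.add nn_contDiff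
  have h0 : ∀ z, 1 + nn z ≠ 0 := fun z => (nn_pos z).ne'
  intro i
  fin_cases i
  · exact (contDiff_const.mul reCLM.contDiff).div h1 h0
  · exact (contDiff_const.mul imCLM.contDiff).div h1 h0
  · exact (nn_contDiff.sub contDiff_const).div h1 h0

lemma sig_contDiffAt {X : VV} (hX : X 2 ≠ 1) : ContDiffAt ℝ ∞ sig X := by
  have hc : ∀ i : Fin 3, ContDiffAt ℝ ∞ (fun X : VV => X i) X := fun i =>
    (EuclideanSpace.proj (𝕜 := ℝ) i).contDiff.contDiffAt
  have hd : ContDiffAt ℝ ∞ (fun X : VV => 1 - X 2) X := contDiffAt_const.sub (hc 2)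
  have h0 : 1 - X 2 ≠ 0 := sub_ne_zero.2 hX.symm
  unfold sig
  exact (ofRealCLM.contDiff.contDiffAt.comp X ((hc 0).div hd h0)).add
    ((ofRealCLM.contDiff.contDiffAt.comp X ((hc 1).div hd h0)).mul contDiffAt_const)

lemma iota_fderiv (z v : ℂ) :
    ‖fderiv ℝ iota z v‖ ^ 2 = 4 / (1 + nn z) ^ 2 * ‖v‖ ^ 2 := by
  have hd : HasFDerivAt iota (fderiv ℝ iota z) z :=
    (iota_contDiff.differentiable (by simp) z).hasFDerivAt
  have hl : HasLineDerivAt ℝ iota (fderiv ℝ iota z v) z v := hd.hasLineDerivAt v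
  have hs := hl.tendsto_slope_zero
  have hs2 := (hs.norm.pow 2)
  refine tendsto_nhds_unique hs2 ?_
  have hcont : Continuous fun t : ℝ => 4 * ‖v‖ ^ 2 / ((1 + nn (z + t • v)) * (1 + nn z)) := by
    refine continuous_const.div ?_ fun t => mul_ne_zero (nn_pos _).ne' (nn_pos _).ne'
    have := nn_contDiff.continuous
    fun_prop
  have ht := (hcont.tendsto 0).mono_left (nhdsWithin_le_nhds (s := {0}ᶜ))
  have e : 4 * ‖v‖ ^ 2 / ((1 + nn (z + (0 : ℝ) • v)) * (1 + nn z))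
    = 4 / (1 + nn z) ^ 2 * ‖v‖ ^ 2 := by
    rw [zero_smul, add_zero]; ring
  rw [e] at ht
  refine ht.congr' ?_
  filter_upwards [self_mem_nhdsWithin] with t ht
  have ht0 : t ≠ 0 := ht
  rw [norm_smul, mul_pow, iota_dist, add_sub_cancel_left, norm_smul, mul_pow, norm_inv]
  have : ‖t‖ ≠ 0 := norm_ne_zero_iff.2 ht0
  have h1 := (nn_pos z).ne'
  have h2 := (nn_pos (z + t • v)).ne'
  field_simp

lemma iota_tendsto : Tendsto iota (cocompact ℂ) (𝓝 NP) := by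
  rw [tendsto_iff_norm_sub_tendsto_zero]
  have h1 : Tendsto (fun z : ℂ => ‖iota z - NP‖ ^ 2) (cocompact ℂ) (𝓝 0) := by
    simp_rw [iota_dist_NP, nn_eq]
    refine Tendsto.div_atTop tendsto_const_nhds ?_
    exact tendsto_atTop_add_const_left _ _
      ((tendsto_pow_atTop two_ne_zero).comp tendsto_norm_cocompact_atTop)
  have := h1.sqrt
  simpa using this

lemma fderiv_inj {F : ℂ → VV} {Q : VV → ℂ} {z : ℂ} (hF : DifferentiableAt ℝ F z)
    (hQ : DifferentiableAt ℝ Q (F z)) (h : ∀ᶠ w in 𝓝 z, Q (F w) = w) {v : ℂ}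
    (hv : fderiv ℝ F z v = 0) : v = 0 := by
  have h1 : HasFDerivAt (fun w => Q (F w)) ((fderiv ℝ Q (F z)).comp (fderiv ℝ F z)) z :=
    hQ.hasFDerivAt.comp z hF.hasFDerivAt
  have h2 := h1.unique ((hasFDerivAt_id z).congr_of_eventuallyEq h)
  have := DFunLike.congr_fun h2 v
  simpa [hv] using this.symm

end Inv17

namespace Inv17
open MeasureTheory Complex Set Filter Topology
open scoped ContDiff Convolution ComplexConjugate RealInnerProductSpace

lemma quad_expand (D : ℂ →L[ℝ] VV) (v : ℂ) :
    ‖D v‖ ^ 2 = ‖D 1‖ ^ 2 * v.re ^ 2 + 2 * ⟪D 1, D I⟫ * v.re * v.im + ‖D I‖ ^ 2 * v.im ^ 2 := by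
  have hv : v = v.re • (1 : ℂ) + v.im • I := by
    apply Complex.ext <;> simp
  conv_lhs => rw [hv]
  rw [map_add, map_smul, map_smul, norm_add_sq_real, norm_smul, norm_smul, inner_smul_left,
    inner_smul_right, mul_pow, mul_pow, Real.norm_eq_abs, Real.norm_eq_abs, sq_abs, sq_abs]
  simp
  ring

lemma core {g : VV → VV} (hg1 : ∀ X, ‖X‖ = 1 → ‖g X‖ = 1) (hg2 : ∀ X, ‖X‖ = 1 → g (g X) = X)
    (hg3 : ∀ X, ‖X‖ = 1 → g X ≠ X) (hF : ContDiff ℝ ∞ fun z => g (iota z))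
    (hF' : ContDiff ℝ ∞ fun z => g (-iota z)) :
    ∃ h h' : ℂ → ℂ, ContDiff ℝ ∞ h ∧ ContDiff ℝ ∞ h' ∧ (∀ z, h' (h z) = z) ∧
      (∀ z, h (h' z) = z) ∧ h (sig (g NP)) = 0 ∧
      ∀ z, z ≠ sig (g NP) → h (sig (g (iota z))) = -(conj (h z))⁻¹ := by
  set p := g NP with hp
  set q := sig p with hq
  have hp1 : ‖p‖ = 1 := hg1 _ NP_norm
  have hpN : p ≠ NP := hg3 _ NP_norm
  have hp2 : p 2 ≠ 1 := two_ne hp1 hpN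
  have hiq : iota q = p := iota_sig hp1 hpN
  set F : ℂ → VV := fun z => g (iota z) with hFdef
  set F' : ℂ → VV := fun z => g (-iota z) with hF'def
  have hFd : ∀ z, DifferentiableAt ℝ F z := fun z => hF.differentiable (by simp) z
  have hF'd : ∀ z, DifferentiableAt ℝ F' z := fun z => hF'.differentiable (by simp) z
  have hFn : ∀ z, ‖F z‖ = 1 := fun z => hg1 _ (iota_norm z)
  have hgF : ∀ z, g (F z) = iota z := fun z => hg2 _ (iota_norm z)
  have hFq : F q = NP := by simp only [hFdef, hiq]; exact hg2 _ NP_norm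
  have hFN : ∀ z, z ≠ q → F z ≠ NP := by
    intro z hz h
    have := hgF z
    rw [h] at this
    apply hz
    rw [hq, hp, this, sig_iota]
  set Φ : ℂ → ℂ := fun z => sig (F z) with hΦdef
  have hiΦ : ∀ z, z ≠ q → iota (Φ z) = F z := fun z hz => iota_sig (hFn z) (hFN z hz)
  have hFΦ : ∀ z, z ≠ q → F (Φ z) = iota z := by
    intro z hz
    show g (iota (Φ z)) = iota z
    rw [hiΦ z hz, hgF]
  have hΦs : ∀ z, z ≠ q → ContDiffAt ℝ ∞ Φ z := fun z hz =>
    (sig_contDiffAt (two_ne (hFn z) (hFN z hz))).comp z hF.contDiffAt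
  have hΦd : ∀ z, z ≠ q → DifferentiableAt ℝ Φ z := fun z hz =>
    (hΦs z hz).differentiableAt (by simp)
  have hΦq : ∀ z, z ≠ q → Φ z ≠ q := by
    intro z hz h
    have := hFΦ z hz
    rw [h, hFq] at this
    exact iota_ne z this.symm
  have hΦinv : ∀ z, z ≠ q → Φ (Φ z) = z := by
    intro z hz
    show sig (F (Φ z)) = z
    rw [hFΦ z hz, sig_iota]
  have hΦfree : ∀ z, z ≠ q → Φ z ≠ z := by
    intro z hz h
    have := hiΦ z hz
    rw [h] at this
    exact hg3 _ (iota_norm z) this.symm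
  have hnear : ∀ z, z ≠ q → ∀ᶠ w in 𝓝 z, w ≠ q := fun z hz => isOpen_ne.mem_nhds hz
  -- behaviour near the pole
  set P : VV → VV := fun X => F' (sig (-X)) with hPdef
  have hPg : ∀ X, ‖X‖ = 1 → X ≠ -NP → P X = g X := by
    intro X hX hXN
    show g (-iota (sig (-X))) = g X
    rw [iota_sig (by rw [norm_neg, hX]) (fun h => hXN (by rw [← h, neg_neg])), neg_neg]
  have hNN : NP ≠ -NP := by
    intro h
    have := congrArg (fun X : VV => X 2) h
    simp only [PiLp.neg_apply, NP_2] at this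
    norm_num at this
  have hPN : P NP = p := hPg _ NP_norm hNN
  have hPd : DifferentiableAt ℝ P NP := by
    have h1 : DifferentiableAt ℝ sig (-NP) := by
      refine (sig_contDiffAt ?_).differentiableAt (by simp)
      rw [PiLp.neg_apply, NP_2]
      norm_num
    have h2 : DifferentiableAt ℝ (fun X : VV => -X) NP := differentiableAt_id.neg
    exact (hF'd _).comp NP (DifferentiableAt.comp NP h1 h2)
  have hFlim : Tendsto F (cocompact ℂ) (𝓝 p) := by
    have h1 : Tendsto (fun z => P (iota z)) (cocompact ℂ) (𝓝 p) := by
      have := hPd.continuousAt.tendsto.comp iota_tendsto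
      rwa [hPN] at this
    refine h1.congr' ?_
    have h2 : ∀ᶠ z in cocompact ℂ, iota z ≠ -NP :=
      iota_tendsto.eventually (isOpen_ne.mem_nhds hNN)
    filter_upwards [h2] with z hz
    exact hPg _ (iota_norm z) hz
  have hsigc : ContinuousAt sig p := (sig_contDiffAt hp2).continuousAt
  have hΦlim : Tendsto Φ (cocompact ℂ) (𝓝 q) := hsigc.tendsto.comp hFlim
  set Q : VV → ℂ := fun X => sig (P X) with hQdef
  have hQd : DifferentiableAt ℝ Q NP := by
    have : DifferentiableAt ℝ sig (P NP) := by
      rw [hPN]; exact (sig_contDiffAt hp2).differentiableAt (by simp)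
    exact DifferentiableAt.comp NP this hPd
  have hFtend : Tendsto F (𝓝 q) (𝓝 NP) := by
    have := (hFd q).continuousAt.tendsto
    rwa [hFq] at this
  have hQF : ∀ᶠ z in 𝓝 q, Q (F z) = z := by
    have h2 : ∀ᶠ z in 𝓝 q, F z ≠ -NP := hFtend.eventually (isOpen_ne.mem_nhds hNN)
    filter_upwards [h2] with z hz
    show sig (P (F z)) = z
    rw [hPg _ (hFn z) hz, hgF, sig_iota]
  have hQN : Q NP = q := by show sig (P NP) = q; rw [hPN]
  obtain ⟨C, hC⟩ : ∃ C : ℝ, ∀ᶠ z in 𝓝[≠] q, ‖Φ z‖ * ‖z - q‖ ≤ C := by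
    obtain ⟨L, hL⟩ := (hQd.isBigO_sub).bound
    refine ⟨2 * |L|, ?_⟩
    have h3 := hFtend.eventually hL
    rw [eventually_nhdsWithin_iff]
    filter_upwards [h3, hQF] with z h3 h4 hz
    rw [h4, hQN] at h3
    have h5 : ‖F z - NP‖ ^ 2 = 4 / (1 + nn (Φ z)) := by rw [← hiΦ z hz, iota_dist_NP]
    have h6 : ‖Φ z‖ * ‖F z - NP‖ ≤ 2 := by
      refine abs_le_of_sq_le_sq' ?_ (by norm_num) |>.2
      rw [mul_pow, h5, ← nn_eq, mul_div_assoc', div_le_iff₀ (nn_pos _)]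
      nlinarith
    calc ‖Φ z‖ * ‖z - q‖ ≤ ‖Φ z‖ * (|L| * ‖F z - NP‖) := by
          gcongr
          exact h3.trans (by gcongr; exact le_abs_self L)
      _ = |L| * (‖Φ z‖ * ‖F z - NP‖) := by ring
      _ ≤ |L| * 2 := by gcongr
      _ = 2 * |L| := by ring
  have hinj : ∀ z v, fderiv ℝ F z v = 0 → v = 0 := by
    intro z v hv
    by_cases hz : z = q
    · subst hz
      exact fderiv_inj (hFd _) (by rw [hFq]; exact hQd) hQF hv
    · refine fderiv_inj (Q := fun X => Φ (sig X)) (hFd z) ?_ ?_ hv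
      · have h1 : DifferentiableAt ℝ sig (F z) :=
          (sig_contDiffAt (two_ne (hFn z) (hFN z hz))).differentiableAt (by simp)
        exact DifferentiableAt.comp (F z) (hΦd (Φ z) (hΦq z hz)) h1
      · filter_upwards [hnear z hz] with w hw
        exact hΦinv w hw
  -- choice of radius
  obtain ⟨r, hr0, hr⟩ : ∃ r : ℝ, 0 < r ∧ ∀ z, ‖iota z - p‖ ≤ r → r < ‖F z - p‖ := by
    have hc : ContinuousAt (fun X => ‖F (sig X) - p‖) p := by
      have h1 : ContinuousAt (fun X => F (sig X)) p :=
        ContinuousAt.comp (f := sig) (g := F) (hFd _).continuousAt hsigc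
      exact (h1.sub continuousAt_const).norm
    have hv : 0 < ‖F (sig p) - p‖ := by
      rw [norm_pos_iff, sub_ne_zero, ← hq, hFq]; exact hpN.symm
    have hev : ∀ᶠ X in 𝓝 p, ‖F (sig p) - p‖ / 2 < ‖F (sig X) - p‖ :=
      hc.tendsto.eventually (lt_mem_nhds (half_lt_self hv))
    obtain ⟨ε, hε, hball⟩ := Metric.eventually_nhds_iff.1 hev
    refine ⟨min (‖F (sig p) - p‖ / 2) (ε / 2), by positivity, fun z hz => ?_⟩
    have h1 : dist (iota z) p < ε := by
      rw [dist_eq_norm]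
      have := hz.trans (min_le_right _ _)
      linarith
    have h2 := hball h1
    rw [sig_iota] at h2
    exact (min_le_left _ _).trans_lt h2
  set α : VV → ℝ := fun X => expNegInvGlue (‖X - p‖ ^ 2 - r ^ 2) with hα
  have hα0 : ∀ X, 0 ≤ α X := fun X => expNegInvGlue.nonneg _
  have hαpos : ∀ X, r < ‖X - p‖ → 0 < α X := by
    intro X hX
    exact expNegInvGlue.pos_of_pos (by nlinarith)
  have hαz : ∀ X, ‖X - p‖ ≤ r → α X = 0 := by
    intro X hX
    exact expNegInvGlue.zero_of_nonpos (by nlinarith [norm_nonneg (X - p)])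
  have hαs : ContDiff ℝ ∞ α :=
    expNegInvGlue.contDiff.comp (((contDiff_id.sub contDiff_const).norm_sq ℝ).sub contDiff_const)
  set a : ℂ → ℝ := fun z => α (iota z) * (4 / (1 + nn z) ^ 2) with ha
  set b : ℂ → ℝ := fun z => α (F z) with hb
  have has : ContDiff ℝ ∞ a :=
    (hαs.comp iota_contDiff).mul (contDiff_const.div ((contDiff_const.add nn_contDiff).pow 2)
      fun z => (pow_pos (nn_pos z) 2).ne')
  have hbs : ContDiff ℝ ∞ b := hαs.comp hF
  have hD : ∀ v, ContDiff ℝ ∞ fun z => fderiv ℝ F z v := fun v =>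
    (hF.fderiv_right (m := ∞) (by simp)).clm_apply contDiff_const
  set gg : ℂ → ℂ → ℝ := fun z v =>
    α (iota z) * ‖fderiv ℝ iota z v‖ ^ 2 + α (F z) * ‖fderiv ℝ F z v‖ ^ 2 with hgg
  set Em : ℂ → ℝ := fun z => a z + b z * ‖fderiv ℝ F z 1‖ ^ 2 with hEm
  set Fm : ℂ → ℝ := fun z => b z * ⟪fderiv ℝ F z 1, fderiv ℝ F z I⟫ with hFm
  set Gm : ℂ → ℝ := fun z => a z + b z * ‖fderiv ℝ F z I‖ ^ 2 with hGm
  have hEs : ContDiff ℝ ∞ Em := has.add (hbs.mul ((hD 1).norm_sq ℝ))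
  have hFs : ContDiff ℝ ∞ Fm := hbs.mul ((hD 1).inner ℝ (hD I))
  have hGs : ContDiff ℝ ∞ Gm := has.add (hbs.mul ((hD I).norm_sq ℝ))
  have hggE : ∀ z v, gg z v = Em z * v.re ^ 2 + 2 * Fm z * v.re * v.im + Gm z * v.im ^ 2 := by
    intro z v
    simp only [hgg, hEm, hFm, hGm, ha, hb]
    rw [iota_fderiv, quad_expand (fderiv ℝ F z) v, ← nn_eq v]
    unfold nn
    ring
  have hggpos : ∀ z v, v ≠ 0 → 0 < gg z v := by
    intro z v hv
    have hv' := norm_pos_iff.2 hv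
    have hnz := nn_pos z
    by_cases h : ‖iota z - p‖ ≤ r
    · refine add_pos_of_nonneg_of_pos (mul_nonneg (hα0 _) (by positivity)) ?_
      have h1 := hαpos _ (hr z h)
      have h2 : 0 < ‖fderiv ℝ F z v‖ := norm_pos_iff.2 fun h => hv (hinj z v h)
      positivity
    · refine add_pos_of_pos_of_nonneg ?_ (mul_nonneg (hα0 _) (by positivity))
      have h1 := hαpos _ (not_le.1 h)
      rw [iota_fderiv]
      positivity
  have hE0 : ∀ z, 0 < Em z := by
    intro z
    have := hggpos z 1 one_ne_zero
    rw [hggE] at this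
    simpa using this
  have hD0 : ∀ z, 0 < Em z * Gm z - Fm z ^ 2 := by
    intro z
    have h1 := hggpos z ⟨Fm z, -Em z⟩ (fun h => (hE0 z).ne' (by
      have := congrArg Complex.im h; simpa using this))
    rw [hggE] at h1
    have h2 : 0 < Em z * (Em z * Gm z - Fm z ^ 2) := by
      refine h1.trans_eq ?_; ring
    exact pos_of_mul_pos_right h2 (hE0 z).le |> fun h => h
  obtain ⟨R, hR⟩ : ∃ R : ℝ, ∀ z, R ≤ ‖z‖ → Em z = Gm z ∧ Fm z = 0 := by
    have hev : ∀ᶠ z in cocompact ℂ, b z = 0 := by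
      filter_upwards [hFlim.eventually (Metric.ball_mem_nhds p hr0)] with z hz
      rw [dist_eq_norm] at hz
      exact hαz _ hz.le
    rw [← Metric.cobounded_eq_cocompact, ← comap_norm_atTop, eventually_comap] at hev
    obtain ⟨R, hR⟩ := eventually_atTop.1 hev
    refine ⟨R, fun z hz => ?_⟩
    have := hR _ hz z rfl
    simp [hEm, hGm, hFm, this]
  obtain ⟨f, f', hf, hf', h1, h2, ⟨M, hM⟩, hiso⟩ := isothermal hEs hFs hGs hE0 hD0 hR
  refine planar hΦs hΦq hΦinv hΦfree hΦlim hC hf hf' h1 h2 hM ?_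
  intro z hz
  obtain ⟨ρ1, hρ1, e1⟩ := hiso (Φ z)
  obtain ⟨ρ2, hρ2, e2⟩ := hiso z
  refine ⟨ρ1 / ρ2, by positivity, fun v => ?_⟩
  rw [e1, e2, ← hggE, ← hggE]
  have c1 : fderiv ℝ iota (Φ z) (fderiv ℝ Φ z v) = fderiv ℝ F z v := by
    have d1 : HasFDerivAt (fun w => iota (Φ w)) ((fderiv ℝ iota (Φ z)).comp (fderiv ℝ Φ z)) z :=
      (iota_contDiff.differentiable (by simp) _).hasFDerivAt.comp z (hΦd z hz).hasFDerivAt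
    have d2 : HasFDerivAt (fun w => iota (Φ w)) (fderiv ℝ F z) z := by
      refine (hFd z).hasFDerivAt.congr_of_eventuallyEq ?_
      filter_upwards [hnear z hz] with w hw
      exact hiΦ w hw
    exact DFunLike.congr_fun (d1.unique d2) v
  have c2 : fderiv ℝ F (Φ z) (fderiv ℝ Φ z v) = fderiv ℝ iota z v := by
    have d1 : HasFDerivAt (fun w => F (Φ w)) ((fderiv ℝ F (Φ z)).comp (fderiv ℝ Φ z)) z :=
      (hFd _).hasFDerivAt.comp z (hΦd z hz).hasFDerivAt
    have d2 : HasFDerivAt (fun w => F (Φ w)) (fderiv ℝ iota z) z := by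
      refine (iota_contDiff.differentiable (by simp) z).hasFDerivAt.congr_of_eventuallyEq ?_
      filter_upwards [hnear z hz] with w hw
      exact hFΦ w hw
    exact DFunLike.congr_fun (d1.unique d2) v
  have hg : gg (Φ z) (fderiv ℝ Φ z v) = gg z v := by
    simp only [hgg]
    rw [c1, c2, hiΦ z hz, hFΦ z hz]
    ring
  rw [hg]
  field_simp

end Inv17

namespace Inv17
open MeasureTheory Complex Set Filter Topology
open scoped ContDiff Convolution ComplexConjugate Manifold

/-- Dimension of the ambient space. -/
local instance factVV : Fact (Module.finrank ℝ (EuclideanSpace ℝ (Fin 3)) = 2 + 1) :=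
  ⟨by simp⟩

lemma sph_norm (x : Sphere2) : ‖(x : VV)‖ = 1 := mem_sphere_zero_iff_norm.1 x.2

/-- Inverse stereographic projection as a map to the sphere. -/
noncomputable def iS (z : ℂ) : Sphere2 := ⟨iota z, mem_sphere_zero_iff_norm.2 (iota_norm z)⟩

/-- The north pole as a point of the sphere. -/
noncomputable def NS : Sphere2 := ⟨NP, mem_sphere_zero_iff_norm.2 NP_norm⟩

lemma ne_NS {x : Sphere2} : x ≠ NS ↔ (x : VV) ≠ NP := by
  rw [Ne, Subtype.ext_iff]; rfl

lemma iS_ne (z : ℂ) : iS z ≠ NS := ne_NS.2 (iota_ne z)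

lemma iS_sig {x : Sphere2} (hx : x ≠ NS) : iS (sig x) = x :=
  Subtype.ext (iota_sig (sph_norm x) (ne_NS.1 hx))

lemma sig_iS (z : ℂ) : sig (iS z) = z := sig_iota z

lemma iS_smooth : ContMDiff 𝓘(ℝ, ℂ) (𝓡 2) ∞ iS :=
  ContMDiff.codRestrict_sphere iota_contDiff.contMDiff _

lemma antipodal_smooth : ContMDiff (𝓡 2) (𝓡 2) ∞ antipodal :=
  contMDiff_neg_sphere

lemma anti_anti (x : Sphere2) : antipodal (antipodal x) = x := Subtype.ext (neg_neg _)

lemma anti_iS {z : ℂ} (hz : z ≠ 0) : antipodal (iS z) = iS (-(conj z)⁻¹) :=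
  Subtype.ext (iota_neg hz)

lemma anti_iS_zero : antipodal (iS 0) = NS := Subtype.ext iota_zero

lemma anti_NS : antipodal NS = iS 0 := by rw [← anti_iS_zero, anti_anti]

lemma sig_smoothAt {x : Sphere2} (hx : x ≠ NS) :
    ContMDiffAt (𝓡 2) 𝓘(ℝ, ℂ) ∞ (fun y : Sphere2 => sig (y : VV)) x :=
  (sig_contDiffAt (two_ne (sph_norm x) (ne_NS.1 hx))).contMDiffAt.comp x
    (contMDiff_coe_sphere x)

open Classical in
/-- Transfer of a plane map to the sphere, fixing the north pole. -/
noncomputable def TS (h : ℂ → ℂ) (x : Sphere2) : Sphere2 :=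
  if x = NS then NS else iS (h (sig x))

lemma TS_NS (h : ℂ → ℂ) : TS h NS = NS := by simp [TS]

lemma TS_ne (h : ℂ → ℂ) {x : Sphere2} (hx : x ≠ NS) : TS h x = iS (h (sig x)) := by
  simp [TS, hx]

lemma TS_TS {h h' : ℂ → ℂ} (hh : ∀ z, h' (h z) = z) (x : Sphere2) : TS h' (TS h x) = x := by
  by_cases hx : x = NS
  · rw [hx, TS_NS, TS_NS]
  · rw [TS_ne h hx, TS_ne h' (iS_ne _), sig_iS, hh, iS_sig hx]

lemma TS_smoothAt {h : ℂ → ℂ} (hh : ContDiff ℝ ∞ h) {x : Sphere2} (hx : x ≠ NS) :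
    ContMDiffAt (𝓡 2) (𝓡 2) ∞ (TS h) x := by
  have h1 : ContMDiffAt (𝓡 2) 𝓘(ℝ, ℂ) ∞ (fun y : Sphere2 => h (sig (y : VV))) x :=
    (hh.contMDiff (sig (x : VV))).comp x (sig_smoothAt hx)
  have h2 : ContMDiffAt (𝓡 2) (𝓡 2) ∞ (fun y : Sphere2 => iS (h (sig (y : VV)))) x :=
    (iS_smooth _).comp x h1
  refine h2.congr_of_eventuallyEq ?_
  filter_upwards [isOpen_ne.mem_nhds hx] with y hy
  exact TS_ne h hy

theorem main (φ : Diffeomorph (𝓡 2) (𝓡 2) Sphere2 Sphere2 (⊤ : ℕ∞))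
    (hinv : ∀ x : Sphere2, φ (φ x) = x) (hfree : ∀ x : Sphere2, φ x ≠ x) :
    ∃ ψ : Diffeomorph (𝓡 2) (𝓡 2) Sphere2 Sphere2 (⊤ : ℕ∞),
      ∀ x : Sphere2, φ x = ψ (antipodal (ψ.symm x)) := by
  classical
  set g : VV → VV := fun X =>
    if h : ‖X‖ = 1 then (φ ⟨X, mem_sphere_zero_iff_norm.2 h⟩ : VV) else 0 with hg
  have hgs : ∀ x : Sphere2, g x = φ x := by
    intro x
    simp only [hg]
    rw [dif_pos (sph_norm x)]
  have hgX : ∀ X, ‖X‖ = 1 → ∃ x : Sphere2, (x : VV) = X := fun X hX =>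
    ⟨⟨X, mem_sphere_zero_iff_norm.2 hX⟩, rfl⟩
  have hφc : ContMDiff (𝓡 2) 𝓘(ℝ, VV) ∞ fun x : Sphere2 => (φ x : VV) :=
    contMDiff_coe_sphere.comp φ.contMDiff
  obtain ⟨h, h', hh, hh', e1, e2, e3, e4⟩ := core (g := g)
    (by rintro X hX; obtain ⟨x, rfl⟩ := hgX X hX; rw [hgs]; exact sph_norm _)
    (by rintro X hX; obtain ⟨x, rfl⟩ := hgX X hX; rw [hgs, hgs, hinv])
    (by rintro X hX; obtain ⟨x, rfl⟩ := hgX X hX; rw [hgs]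
        exact fun h => hfree x (Subtype.ext h))
    (by
      have := (hφc.comp iS_smooth).contDiff
      convert this using 1
      exact funext fun z => hgs (iS z))
    (by
      have := (hφc.comp (antipodal_smooth.comp iS_smooth)).contDiff
      convert this using 1
      exact funext fun z => hgs (antipodal (iS z)))
  have hgN : g NP = φ NS := hgs NS
  rw [hgN] at e3 e4
  have hφN : φ NS ≠ NS := hfree NS
  have hz0 : ∀ z, h z = 0 → z = sig (φ NS) := by
    intro z hz
    rw [← e1 z, hz, ← e3, e1]
  have key : ∀ x, TS h (φ x) = antipodal (TS h x) := by
    intro x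
    by_cases hx : x = NS
    · rw [hx, TS_NS, TS_ne h hφN, e3, anti_NS]
    · by_cases hx' : x = φ NS
      · rw [hx', hinv, TS_NS, TS_ne h hφN, e3, anti_iS_zero]
      · have h1 : φ x ≠ NS := fun hc => hx' (by rw [← hc, hinv])
        have h2 : sig x ≠ sig (φ NS) := fun hc => hx' (by rw [← iS_sig hx, hc, iS_sig hφN])
        have h3 : g (iota (sig x)) = φ x := by
          have := hgs (iS (sig x))
          rw [iS_sig hx] at this
          rw [iota_sig (sph_norm x) (ne_NS.1 hx)]
          exact this
        have h4 := e4 _ h2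
        rw [h3] at h4
        rw [TS_ne h h1, TS_ne h hx, h4, anti_iS fun hc => h2 (hz0 _ hc)]
  have keyA : ∀ x, TS h x = antipodal (TS h (φ x)) := fun x => by rw [key, anti_anti]
  have keyB : ∀ x, φ x = TS h' (antipodal (TS h x)) := fun x => by rw [← key, TS_TS e1]
  have keyC : ∀ y, TS h' y = φ (TS h' (antipodal y)) := fun y => by
    have := keyB (TS h' y)
    rw [TS_TS e2] at this
    rw [← this, hinv]
  have s1 : ContMDiff (𝓡 2) (𝓡 2) ∞ (TS h) := by
    intro x
    by_cases hx : x = NS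
    · subst hx
      have : ContMDiffAt (𝓡 2) (𝓡 2) ∞ (fun x => antipodal (TS h (φ x))) NS :=
        (antipodal_smooth _).comp NS ((TS_smoothAt hh hφN).comp NS (φ.contMDiff NS))
      exact this.congr_of_eventuallyEq (Eventually.of_forall keyA)
    · exact TS_smoothAt hh hx
  have s2 : ContMDiff (𝓡 2) (𝓡 2) ∞ (TS h') := by
    intro x
    by_cases hx : x = NS
    · subst hx
      have hne : antipodal NS ≠ NS := by rw [anti_NS]; exact iS_ne 0
      have : ContMDiffAt (𝓡 2) (𝓡 2) ∞ (fun x => φ (TS h' (antipodal x))) NS :=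
        (φ.contMDiff _).comp NS ((TS_smoothAt hh' hne).comp NS (antipodal_smooth NS))
      exact this.congr_of_eventuallyEq (Eventually.of_forall keyC)
    · exact TS_smoothAt hh' hx
  exact ⟨⟨⟨TS h', TS h, TS_TS e2, TS_TS e1⟩, s2, s1⟩, keyB⟩

end Inv17

/-- Every fixed-point-free smooth involution of the 2-sphere is smoothly
conjugate to the antipodal map: `φ = ψ ∘ 𝔞 ∘ ψ⁻¹` for some diffeomorphism `ψ`. -/
theorem stmt17 (φ : Diffeomorph (𝓡 2) (𝓡 2) Sphere2 Sphere2 (⊤ : ℕ∞))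
    (hinv : ∀ x : Sphere2, φ (φ x) = x) (hfree : ∀ x : Sphere2, φ x ≠ x) :
    ∃ ψ : Diffeomorph (𝓡 2) (𝓡 2) Sphere2 Sphere2 (⊤ : ℕ∞),
      ∀ x : Sphere2, φ x = ψ (antipodal (ψ.symm x)) := by
  exact Inv17.main φ hinv hfree
end

section
/- A closed, swap-invariant subset of S² × S² avoiding the diagonal, whose two coordinate projections are covering maps, is the graph of a fixed-point-free involution: let Ñ ⊆ S² × S² be nonempty and closed, with (y,x) ∈ Ñ whenever (x,y) ∈ Ñ, with (x,x) ∉ Ñ for all x, and such that each of the two restrictions to Ñ of the coordinate projections S² × S² → S² is a covering map onto S². Then there is a unique continuous map φ : S² → S² with Ñ = {(x, φ(x)) : x ∈ S²}, and this φ satisfies φ ∘ φ = id and φ(x) ≠ x for all x (in particular φ is a homeomorphism). -/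
open Complex in
/-- Winding number obstruction. -/
lemma winding_core (F G : ℂ → ℂ) (hF : Continuous F) (hG : Continuous G)
    (hF0 : ∀ z, F z ≠ 0) (hG0 : ∀ z, G z ≠ 0)
    (h : ∀ z : ℂ, ‖z‖ = 1 → G z * (starRingEnd ℂ) z = -((starRingEnd ℂ) (F z) * z)) : False := by
  have key : ∀ F : ℂ → ℂ, Continuous F → (∀ z, F z ≠ 0) →
      ∃ L : ℂ → ℂ, Continuous L ∧ ∀ z, exp (L z) = F z := by
    intro F hF hF0
    obtain ⟨L, ⟨-, hL⟩, -⟩ := isCoveringMapOn_exp.existsUnique_continuousMap_lifts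
      (⟨F, hF⟩ : C(ℂ, ℂ)) (a₀ := 0) (e₀ := Complex.log (F 0)) (exp_log (hF0 0))
      (fun z => hF0 z)
    exact ⟨L, L.continuous, fun z => congrFun hL z⟩
  obtain ⟨LF, cF, eF⟩ := key F hF hF0
  obtain ⟨LG, cG, eG⟩ := key G hG hG0
  let h' : ℝ → ℂ := fun t => LG (exp (t * I)) - (starRingEnd ℂ) (LF (exp (t * I))) - 2 * (t * I)
  have hc : Continuous h' := by
    have := continuous_conj
    fun_prop
  have he : ∀ t, exp (h' t) = -1 := by
    intro t
    have h1 : ‖exp (t * I)‖ = 1 := norm_exp_ofReal_mul_I t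
    have h2 := h _ h1
    have h3 : (starRingEnd ℂ) (exp (t * I)) * exp (t * I) = 1 := by
      rw [conj_mul', h1]; simp
    have h4 : (starRingEnd ℂ) (F (exp (t * I))) ≠ 0 := by
      simpa using hF0 _
    have h5 := exp_ne_zero (t * I)
    simp only [h']
    rw [exp_sub, exp_sub, eG, exp_conj, eF, two_mul, exp_add]
    field_simp
    linear_combination exp (t * I) * h2 - G (exp (t * I)) * h3
  have hconst := isCoveringMap_exp.const_of_comp hc
    (fun a a' => Subtype.ext ((he a).trans (he a').symm)) (2 * Real.pi) 0
  simp only [h'] at hconst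
  have e1 : exp (((2 * Real.pi : ℝ) : ℂ) * I) = 1 := by
    push_cast
    exact exp_two_pi_mul_I
  have e2 : exp (((0 : ℝ) : ℂ) * I) = 1 := by simp
  rw [e1, e2] at hconst
  have := congrArg Complex.im hconst
  simp at this

/-- Coordinates of a point of the sphere. -/
lemma sphere_coord (p : Sphere2) : p.1 0 ^ 2 + p.1 1 ^ 2 + p.1 2 ^ 2 = 1 := by
  have h := EuclideanSpace.real_norm_sq_eq p.1
  have h2 : ‖p.1‖ = 1 := by simpa using p.2
  rw [h2, Fin.sum_univ_three] at h
  linarith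

lemma sphere_ext {p q : Sphere2} (h0 : p.1 0 = q.1 0) (h1 : p.1 1 = q.1 1)
    (h2 : p.1 2 = q.1 2) : p = q := by
  apply Subtype.ext
  ext i
  fin_cases i <;> assumption

/-- The denominator `1 - ⟨a,p⟩`. -/
noncomputable def dd (p a : Sphere2) : ℝ :=
  1 - (a.1 0 * p.1 0 + a.1 1 * p.1 1 + a.1 2 * p.1 2)

lemma dd_ne {p a : Sphere2} (h : a ≠ p) : dd p a ≠ 0 := by
  intro h0
  apply h
  have ha := sphere_coord a
  have hp := sphere_coord p
  unfold dd at h0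
  have : (a.1 0 - p.1 0) ^ 2 + (a.1 1 - p.1 1) ^ 2 + (a.1 2 - p.1 2) ^ 2 = 0 := by
    linear_combination ha + hp + 2 * h0
  apply sphere_ext <;> nlinarith [sq_nonneg (a.1 0 - p.1 0), sq_nonneg (a.1 1 - p.1 1),
    sq_nonneg (a.1 2 - p.1 2)]

/-- Tangent vector at `p`, the difference of the stereographic images of `a`, `b`. -/
noncomputable def VV (p a b : Sphere2) (i : Fin 3) : ℝ :=
  (a.1 i - p.1 i) / dd p a - (b.1 i - p.1 i) / dd p b

lemma VV_tangent {p a b : Sphere2} (ha : a ≠ p) (hb : b ≠ p) :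
    VV p a b 0 * p.1 0 + VV p a b 1 * p.1 1 + VV p a b 2 * p.1 2 = 0 := by
  have h1 := dd_ne ha
  have h2 := dd_ne hb
  have hp := sphere_coord p
  have e1 : dd p a = 1 - (a.1 0 * p.1 0 + a.1 1 * p.1 1 + a.1 2 * p.1 2) := rfl
  have e2 : dd p b = 1 - (b.1 0 * p.1 0 + b.1 1 * p.1 1 + b.1 2 * p.1 2) := rfl
  unfold VV
  field_simp
  linear_combination (dd p a - dd p b) * hp + dd p b * e1 - dd p a * e2

lemma VV_ne {p a b : Sphere2} (ha : a ≠ p) (hb : b ≠ p) (hab : a ≠ b)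
    (h0 : VV p a b 0 = 0) (h1 : VV p a b 1 = 0) (h2 : VV p a b 2 = 0) : False := by
  have da := dd_ne ha
  have db := dd_ne hb
  have sp := sphere_coord p
  have sa := sphere_coord a
  have sb := sphere_coord b
  have e1 : dd p a = 1 - (a.1 0 * p.1 0 + a.1 1 * p.1 1 + a.1 2 * p.1 2) := rfl
  have e2 : dd p b = 1 - (b.1 0 * p.1 0 + b.1 1 * p.1 1 + b.1 2 * p.1 2) := rfl
  unfold VV at h0 h1 h2
  have na : (a.1 0 - p.1 0) ^ 2 + (a.1 1 - p.1 1) ^ 2 + (a.1 2 - p.1 2) ^ 2 = 2 * dd p a := by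
    linear_combination sa + sp - 2 * e1
  have nb : (b.1 0 - p.1 0) ^ 2 + (b.1 1 - p.1 1) ^ 2 + (b.1 2 - p.1 2) ^ 2 = 2 * dd p b := by
    linear_combination sb + sp - 2 * e2
  have k0 := sub_eq_zero.1 h0
  have k1 := sub_eq_zero.1 h1
  have k2 := sub_eq_zero.1 h2
  have qa : ((a.1 0 - p.1 0) / dd p a) ^ 2 + ((a.1 1 - p.1 1) / dd p a) ^ 2
      + ((a.1 2 - p.1 2) / dd p a) ^ 2 = 2 / dd p a := by
    field_simp
    linear_combination na
  have qb : ((b.1 0 - p.1 0) / dd p b) ^ 2 + ((b.1 1 - p.1 1) / dd p b) ^ 2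
      + ((b.1 2 - p.1 2) / dd p b) ^ 2 = 2 / dd p b := by
    field_simp
    linear_combination nb
  rw [k0, k1, k2, qb] at qa
  have hd : dd p a = dd p b := by
    field_simp at qa
    linarith
  rw [hd, div_left_inj' db] at k0 k1 k2
  exact hab (sphere_ext (by linarith) (by linarith) (by linarith))

/-- Inverse stereographic projections, `s = 1` or `s = -1`. -/
noncomputable def rho (s : ℝ) (hs : s ^ 2 = 1) (z : ℂ) : Sphere2 :=
  ⟨!₂[2 * z.re / (1 + (z.re ^ 2 + z.im ^ 2)), 2 * z.im / (1 + (z.re ^ 2 + z.im ^ 2)),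
    s * ((z.re ^ 2 + z.im ^ 2) - 1) / (1 + (z.re ^ 2 + z.im ^ 2))], by
    have hpos : 1 + (z.re ^ 2 + z.im ^ 2) ≠ 0 := by positivity
    rw [mem_sphere_zero_iff_norm, ← sq_eq_sq₀ (norm_nonneg _) zero_le_one,
      EuclideanSpace.real_norm_sq_eq, Fin.sum_univ_three]
    simp
    field_simp
    linear_combination ((z.re ^ 2 + z.im ^ 2) - 1) ^ 2 * hs⟩

lemma rho_0 (s hs z) : (rho s hs z).1 0 = 2 * z.re / (1 + (z.re ^ 2 + z.im ^ 2)) := rfl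
lemma rho_1 (s hs z) : (rho s hs z).1 1 = 2 * z.im / (1 + (z.re ^ 2 + z.im ^ 2)) := rfl
lemma rho_2 (s hs z) :
  (rho s hs z).1 2 = s * ((z.re ^ 2 + z.im ^ 2) - 1) / (1 + (z.re ^ 2 + z.im ^ 2)) := rfl

lemma rho_continuous (s hs) : Continuous (rho s hs) := by
  apply Continuous.subtype_mk
  apply (PiLp.continuous_toLp 2 _).comp
  apply continuous_pi
  intro i
  have hpos : ∀ z : ℂ, 1 + (z.re ^ 2 + z.im ^ 2) ≠ 0 := fun z => by positivity
  have := Complex.continuous_re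
  have := Complex.continuous_im
  fin_cases i <;> simp <;> refine Continuous.div ?_ ?_ hpos <;> fun_prop

lemma rho_surj (p : Sphere2) : ∃ s hs z, rho s hs z = p := by
  have hp := sphere_coord p
  obtain ⟨s, hs, hne⟩ : ∃ s : ℝ, s ^ 2 = 1 ∧ 1 - s * p.1 2 ≠ 0 := by
    by_cases h : p.1 2 = 1
    · exact ⟨-1, by norm_num, by rw [h]; norm_num⟩
    · exact ⟨1, by norm_num, fun h' => h (by linarith)⟩
  refine ⟨s, hs, ⟨p.1 0 / (1 - s * p.1 2), p.1 1 / (1 - s * p.1 2)⟩, ?_⟩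
  have e : 1 + ((p.1 0 / (1 - s * p.1 2)) ^ 2 + (p.1 1 / (1 - s * p.1 2)) ^ 2)
      = 2 / (1 - s * p.1 2) := by
    field_simp
    linear_combination hp + (p.1 2) ^ 2 * hs
  have e' : ((p.1 0 / (1 - s * p.1 2)) ^ 2 + (p.1 1 / (1 - s * p.1 2)) ^ 2)
      = 2 / (1 - s * p.1 2) - 1 := by linarith
  apply sphere_ext
  · rw [rho_0]; simp only; rw [e]; field_simp
  · rw [rho_1]; simp only; rw [e]; field_simp
  · rw [rho_2]; simp only; rw [e, e']; field_simp
    linear_combination 2 * (p.1 2) * hs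

lemma rho_circle (s hs s' hs') (z : ℂ) (hz : ‖z‖ = 1) : rho s hs z = rho s' hs' z := by
  have h : z.re ^ 2 + z.im ^ 2 = 1 := by
    have := Complex.sq_norm z
    rw [hz, Complex.normSq_apply] at this
    linarith
  apply sphere_ext
  · rfl
  · rfl
  · rw [rho_2, rho_2, h]; simp

/-- The vector field in the chart. -/
noncomputable def ff (s : ℝ) (z : ℂ) (p a b : Sphere2) : ℂ :=
  ⟨VV p a b 0 + s * z.re * VV p a b 2, VV p a b 1 + s * z.im * VV p a b 2⟩

lemma ff_ne {s hs z a b} (ha : a ≠ rho s hs z) (hb : b ≠ rho s hs z) (hab : a ≠ b) :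
    ff s z (rho s hs z) a b ≠ 0 := by
  intro h
  have hre : VV (rho s hs z) a b 0 + s * z.re * VV (rho s hs z) a b 2 = 0 := congrArg Complex.re h
  have him : VV (rho s hs z) a b 1 + s * z.im * VV (rho s hs z) a b 2 = 0 := congrArg Complex.im h
  have ht := VV_tangent ha hb
  rw [rho_0, rho_1, rho_2] at ht
  have hpos : 1 + (z.re ^ 2 + z.im ^ 2) ≠ 0 := by positivity
  have hs0 : s ≠ 0 := by rintro rfl; norm_num at hs
  field_simp at ht
  have hv : (s * (1 + (z.re ^ 2 + z.im ^ 2))) * VV (rho s hs z) a b 2 = 0 := by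
    linear_combination 2 * z.re * hre + 2 * z.im * him - ht
  have hv := (mul_eq_zero.1 hv).resolve_left (mul_ne_zero hs0 hpos)
  rw [hv] at hre him
  exact VV_ne ha hb hab (by linarith) (by linarith) hv

lemma ff_circle {s hs z a b} (hz : ‖z‖ = 1) (ha : a ≠ rho s hs z) (hb : b ≠ rho s hs z) :
    ff (-s) z (rho s hs z) a b * (starRingEnd ℂ) z
      = -((starRingEnd ℂ) (ff s z (rho s hs z) a b) * z) := by
  have h : z.re ^ 2 + z.im ^ 2 = 1 := by
    have := Complex.sq_norm z
    rw [hz, Complex.normSq_apply] at this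
    linarith
  have ht := VV_tangent ha hb
  rw [rho_0, rho_1, rho_2, h] at ht
  apply Complex.ext
  · simp [ff]
    linear_combination 2 * ht
  · simp [ff]
    ring

lemma ff_continuous (s hs) {A B : ℂ → Sphere2} (hA : Continuous A) (hB : Continuous B)
    (hA' : ∀ z, A z ≠ rho s hs z) (hB' : ∀ z, B z ≠ rho s hs z) :
    Continuous fun z => ff s z (rho s hs z) (A z) (B z) := by
  have coord : ∀ (A : ℂ → Sphere2), Continuous A → ∀ i, Continuous fun z => (A z).1 i := by
    intro A hA i
    exact (PiLp.continuous_apply 2 (fun _ : Fin 3 => ℝ) i).comp (continuous_subtype_val.comp hA)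
  have hr := coord _ (rho_continuous s hs)
  have hd : ∀ A : ℂ → Sphere2, Continuous A → Continuous fun z => dd (rho s hs z) (A z) := by
    intro A hA
    have h := coord A hA
    exact continuous_const.sub ((((h 0).mul (hr 0)).add ((h 1).mul (hr 1))).add ((h 2).mul (hr 2)))
  have hV : ∀ i, Continuous fun z => VV (rho s hs z) (A z) (B z) i := by
    intro i
    unfold VV
    exact (((coord A hA i).sub (hr i)).div (hd A hA) fun z => dd_ne (hA' z)).sub
      (((coord B hB i).sub (hr i)).div (hd B hB) fun z => dd_ne (hB' z))
  have hre := Complex.continuous_re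
  have him := Complex.continuous_im
  have h0 := hV 0
  have h1 := hV 1
  have h2 := hV 2
  have : (fun z => ff s z (rho s hs z) (A z) (B z)) = fun z =>
      (((VV (rho s hs z) (A z) (B z) 0 + s * z.re * VV (rho s hs z) (A z) (B z) 2 : ℝ) : ℂ)) +
      (((VV (rho s hs z) (A z) (B z) 1 + s * z.im * VV (rho s hs z) (A z) (B z) 2 : ℝ) : ℂ))
        * Complex.I := by
    funext z
    exact (Complex.re_add_im (ff s z (rho s hs z) (A z) (B z))).symm
  rw [this]
  fun_prop

lemma fiber_unique (N : Set (Sphere2 × Sphere2))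
    (hdiag : ∀ x : Sphere2, (x, x) ∉ N)
    (hcov : IsCoveringMap (fun p : N => (p : Sphere2 × Sphere2).1)) :
    Function.Injective (fun p : N => (p : Sphere2 × Sphere2).1) := by
  intro e₁ e₂ he
  by_contra hne
  obtain ⟨s, hs, z₀, hz₀⟩ := rho_surj e₁.1.1
  have lift : ∀ (s : ℝ) (hs : s ^ 2 = 1) (z : ℂ) (e : N), e.1.1 = rho s hs z →
      ∃ A : C(ℂ, N), A z = e ∧ ∀ w, (A w).1.1 = rho s hs w := by
    intro s hs z e h
    obtain ⟨A, ⟨h1, h2⟩, -⟩ := hcov.existsUnique_continuousMap_lifts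
      ⟨rho s hs, rho_continuous s hs⟩ z e h
    exact ⟨A, h1, fun w => congrFun h2 w⟩
  have disj : ∀ A B : C(ℂ, N), (∀ w, (A w).1.1 = (B w).1.1) → ∀ z, A z ≠ B z →
      ∀ w, A w ≠ B w := by
    intro A B h z hz w hw
    exact hz (congrFun (hcov.eq_of_comp_eq A.continuous B.continuous (funext h) w hw) z)
  have hs' : (-s) ^ 2 = 1 := by rw [neg_sq, hs]
  obtain ⟨A₁, hA₁, pA₁⟩ := lift s hs z₀ e₁ hz₀.symm
  obtain ⟨A₂, hA₂, pA₂⟩ := lift s hs z₀ e₂ (he.symm.trans hz₀.symm)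
  have hA := disj A₁ A₂ (fun w => (pA₁ w).trans (pA₂ w).symm) z₀ (by rw [hA₁, hA₂]; exact hne)
  have hc := rho_circle s hs (-s) hs'
  obtain ⟨B₁, hB₁, pB₁⟩ := lift (-s) hs' 1 (A₁ 1) ((pA₁ 1).trans (hc 1 (by simp)))
  obtain ⟨B₂, hB₂, pB₂⟩ := lift (-s) hs' 1 (A₂ 1) ((pA₂ 1).trans (hc 1 (by simp)))
  have hB := disj B₁ B₂ (fun w => (pB₁ w).trans (pB₂ w).symm) 1 (by rw [hB₁, hB₂]; exact hA 1)
  have hconn : IsPreconnected (Metric.sphere (0 : ℂ) 1) :=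
    (isConnected_sphere (by rw [Complex.rank_real_complex]; norm_num) 0 zero_le_one).isPreconnected
  have agree : ∀ A B : C(ℂ, N), (∀ w, (A w).1.1 = rho s hs w) → (∀ w, (B w).1.1 = rho (-s) hs' w) →
      B 1 = A 1 → ∀ z : ℂ, ‖z‖ = 1 → B z = A z := by
    intro A B pA pB h z hz
    refine hcov.eqOn_of_comp_eqOn hconn B.continuous.continuousOn A.continuous.continuousOn
      (a := 1) ?_ (by simp) h (by simpa using hz)
    intro w hw
    have hw : ‖w‖ = 1 := by simpa using hw
    exact (pB w).trans ((hc w hw).symm.trans (pA w).symm)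
  have g₁ := agree A₁ B₁ pA₁ pB₁ hB₁
  have g₂ := agree A₂ B₂ pA₂ pB₂ hB₂
  have off : ∀ (s hs) (A : C(ℂ, N)), (∀ w, (A w).1.1 = rho s hs w) → ∀ w,
      (A w).1.2 ≠ rho s hs w := by
    intro s hs A pA w h
    apply hdiag (A w).1.1
    have : (A w).1 = ((A w).1.1, (A w).1.1) := Prod.ext rfl (h.trans (pA w).symm)
    rw [← this]
    exact (A w).2
  have ne2 : ∀ (A B : C(ℂ, N)), (∀ w, (A w).1.1 = (B w).1.1) → (∀ w, A w ≠ B w) → ∀ w,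
      (A w).1.2 ≠ (B w).1.2 :=
    fun A B h h' w h'' => h' w (Subtype.ext (Prod.ext (h w) h''))
  have c2 : ∀ A : C(ℂ, N), Continuous fun z => (A z).1.2 := fun A => by fun_prop
  refine winding_core (fun z => ff s z (rho s hs z) (A₁ z).1.2 (A₂ z).1.2)
    (fun z => ff (-s) z (rho (-s) hs' z) (B₁ z).1.2 (B₂ z).1.2)
    (ff_continuous s hs (c2 A₁) (c2 A₂) (off s hs A₁ pA₁) (off s hs A₂ pA₂))
    (ff_continuous (-s) hs' (c2 B₁) (c2 B₂) (off _ hs' B₁ pB₁) (off _ hs' B₂ pB₂))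
    (fun z => ff_ne (off s hs A₁ pA₁ z) (off s hs A₂ pA₂ z)
      (ne2 A₁ A₂ (fun w => (pA₁ w).trans (pA₂ w).symm) hA z))
    (fun z => ff_ne (off _ hs' B₁ pB₁ z) (off _ hs' B₂ pB₂ z)
      (ne2 B₁ B₂ (fun w => (pB₁ w).trans (pB₂ w).symm) hB z)) ?_
  intro z hz
  rw [g₁ z hz, g₂ z hz, ← hc z hz]
  exact ff_circle hz (off s hs A₁ pA₁ z) (off s hs A₂ pA₂ z)

/-- A closed, swap-invariant subset of `S² × S²` avoiding the diagonal, whose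
two coordinate projections are covering maps onto `S²`, is the graph of a
(unique) fixed-point-free continuous involution of `S²`. -/
theorem stmt18 (N : Set (Sphere2 × Sphere2)) (hne : N.Nonempty)
    (hcl : IsClosed N)
    (hsym : ∀ p ∈ N, (p.2, p.1) ∈ N)
    (hdiag : ∀ x : Sphere2, (x, x) ∉ N)
    (hcov₁ : IsCoveringMap (fun p : N => (p : Sphere2 × Sphere2).1))
    (hsurj₁ : Function.Surjective (fun p : N => (p : Sphere2 × Sphere2).1))
    (hcov₂ : IsCoveringMap (fun p : N => (p : Sphere2 × Sphere2).2))
    (hsurj₂ : Function.Surjective (fun p : N => (p : Sphere2 × Sphere2).2)) :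
    (∃! φ : C(Sphere2, Sphere2), N = Set.range fun x => (x, φ x)) ∧
      ∀ φ : C(Sphere2, Sphere2), (N = Set.range fun x => (x, φ x)) →
        (∀ x, φ (φ x) = x) ∧ (∀ x, φ x ≠ x) := by
  have hinj := fiber_unique N hdiag hcov₁
  let e := hcov₁.isLocalHomeomorph.toHomeomorphOfBijective ⟨hinj, hsurj₁⟩
  have he : ∀ x, (e.symm x).1.1 = x := fun x => e.apply_symm_apply x
  have uniq : ∀ x y y', (x, y) ∈ N → (x, y') ∈ N → y = y' := by
    intro x y y' h h'
    have h1 : (⟨(x, y), h⟩ : N) = ⟨(x, y'), h'⟩ := hinj rfl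
    exact congrArg (fun p : N => p.1.2) h1
  have mem : ∀ φ : C(Sphere2, Sphere2), (N = Set.range fun x => (x, φ x)) →
      ∀ x, (x, φ x) ∈ N := by
    intro φ h x
    rw [h]
    exact ⟨x, rfl⟩
  refine ⟨⟨⟨fun x => (e.symm x).1.2, by fun_prop⟩, ?_, ?_⟩, ?_⟩
  · have hm : ∀ x, (x, (e.symm x).1.2) ∈ N := by
      intro x
      have : (x, (e.symm x).1.2) = (e.symm x).1 := Prod.ext (he x).symm rfl
      rw [this]
      exact (e.symm x).2
    ext ⟨x, y⟩
    constructor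
    · intro h
      exact ⟨x, Prod.ext rfl (uniq x _ _ (hm x) h)⟩
    · rintro ⟨w, hw⟩
      rw [← hw]
      exact hm w
  · intro ψ hψ
    ext1 x
    have : (x, (e.symm x).1.2) = (e.symm x).1 := Prod.ext (he x).symm rfl
    exact uniq x _ _ (mem ψ hψ x) (this ▸ (e.symm x).2)
  · intro φ hφ
    refine ⟨fun x => uniq (φ x) _ _ (mem φ hφ (φ x)) (hsym _ (mem φ hφ x)), fun x hx => ?_⟩
    have := mem φ hφ x
    rw [hx] at this
    exact hdiag x this
end
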